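/- arXiv:2602.20025 — 3 statements merged into one kernel-verified Lean document; each statement's English description precedes it below -/
import Mathlib

section
/- For every integer n ≥ 0 and every r with 1 ≤ r ≤ 4, DSOME(25n + 5r + 1) ≡ 0 (mod 4). -/
open PowerSeries

/-- `DSOME n`: the sum, over all partitions of `n` into distinct parts, of
(the sum of the odd parts) minus (the sum of the even parts). `DSOME 0 = 0`. -/
def DSOME (n : ℕ) : ℤ :=
  ∑ p ∈ Nat.Partition.distincts n,
    (((p.parts.filter (fun i => Odd i)).sum : ℤ) - ((p.parts.filter (fun i => Even i)).sum : ℤ))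

/-- Finite sets of positive integers with sum `n`. -/
def distinctSets (n : ℕ) : Finset (Finset ℕ) :=
  {T ∈ (Finset.Icc 1 n).powerset | ∑ i ∈ T, i = n}

theorem mem_distinctSets {n : ℕ} {T : Finset ℕ} :
    T ∈ distinctSets n ↔ 0 ∉ T ∧ ∑ i ∈ T, i = n := by
  simp only [distinctSets, Finset.mem_filter, Finset.mem_powerset]
  refine ⟨fun h => ⟨fun h0 => by simpa using h.1 h0, h.2⟩, fun h => ⟨fun i hi => ?_, h.2⟩⟩
  have h1 : i ≤ ∑ i ∈ T, i := Finset.single_le_sum (f := fun i => i) (fun _ _ => Nat.zero_le _) hi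
  have h2 : i ≠ 0 := fun h0 => h.1 (h0 ▸ hi)
  simp only [Finset.mem_Icc]
  omega

theorem card_distincts_eq (n : ℕ) :
    (Nat.Partition.distincts n).card = (distinctSets n).card := by
  refine Finset.card_bij (fun p _ => p.parts.toFinset) ?_ ?_ ?_
  · intro p hp
    have hnd : p.parts.Nodup := by simpa [Nat.Partition.distincts] using hp
    rw [mem_distinctSets]
    refine ⟨fun h0 => lt_irrefl 0 (p.parts_pos (by simpa using h0)), ?_⟩
    rw [Finset.sum, Multiset.toFinset_val, hnd.dedup, Multiset.map_id', p.parts_sum]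
  · intro p hp q hq h
    have hp' : p.parts.Nodup := by simpa [Nat.Partition.distincts] using hp
    have hq' : q.parts.Nodup := by simpa [Nat.Partition.distincts] using hq
    ext1
    rw [← hp'.dedup, ← hq'.dedup]
    simpa using congrArg Finset.val h
  · intro T hT
    rw [mem_distinctSets] at hT
    refine ⟨⟨T.val, fun {i} hi => Nat.pos_of_ne_zero fun h0 => hT.1 (h0 ▸ hi), ?_⟩, ?_, ?_⟩
    · rw [← hT.2, Finset.sum, Multiset.map_id']
    · simpa [Nat.Partition.distincts] using T.nodup
    · simp

theorem sum_neg_one_pow_card_distinctSets (n : ℕ) :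
    ∑ T ∈ distinctSets n, (-1 : ℤ) ^ T.card = (pentagonalSeries ℤ).coeff n := by
  obtain ⟨s, hs⟩ := Filter.eventually_atTop.1 (coeff_prod_one_sub_X_pow_eventually_eq ℤ n)
  rw [← hs (s ∪ Finset.range n) Finset.subset_union_left]
  have key : ∀ U : Finset ℕ, ∏ i ∈ U, (1 - X ^ (i + 1) : ℤ⟦X⟧) =
      ∑ T ∈ U.powerset, (-1 : ℤ⟦X⟧) ^ T.card * X ^ (∑ i ∈ T, (i + 1)) := by
    intro U
    simp_rw [sub_eq_add_neg]
    rw [Finset.prod_one_add]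
    refine Finset.sum_congr rfl fun T _ => ?_
    rw [Finset.prod_neg, Finset.prod_pow_eq_pow_sum]
  have hc : ∀ k : ℕ, (-1 : ℤ⟦X⟧) ^ k = C ((-1) ^ k) := by intro k; simp
  rw [key, map_sum]
  simp_rw [hc, coeff_C_mul, coeff_X_pow, mul_ite, mul_one, mul_zero]
  rw [← Finset.sum_filter]
  symm
  refine Finset.sum_bij (fun T _ => T.map (addRightEmbedding 1)) ?_ ?_ ?_ ?_
  · intro T hT
    simp only [Finset.mem_filter] at hT
    rw [mem_distinctSets]
    simp [hT.2]
  · intro T _ T' _ h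
    exact Finset.map_injective _ h
  · intro T hT
    have hT' := hT
    rw [mem_distinctSets] at hT'
    have himg : (T.image (· - 1)).map (addRightEmbedding 1) = T := by
      ext i
      simp only [Finset.mem_map, Finset.mem_image, addRightEmbedding_apply, exists_exists_and_eq_and]
      constructor
      · rintro ⟨a, ha, rfl⟩
        have : a ≠ 0 := fun h0 => hT'.1 (h0 ▸ ha)
        rwa [Nat.sub_add_cancel (by omega)]
      · intro hi
        have : i ≠ 0 := fun h0 => hT'.1 (h0 ▸ hi)
        exact ⟨i, hi, by omega⟩
    refine ⟨T.image (· - 1), ?_, himg⟩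
    simp only [Finset.mem_filter, Finset.mem_powerset]
    constructor
    · intro i hi
      simp only [Finset.mem_image] at hi
      obtain ⟨a, ha, rfl⟩ := hi
      have := (Finset.mem_Icc.1 (Finset.mem_powerset.1 (Finset.mem_filter.1 hT).1 ha))
      exact Finset.mem_union_right _ (Finset.mem_range.2 (by omega))
    · have h := hT'.2
      rw [← himg, Finset.sum_map] at h
      simpa only [addRightEmbedding_apply] using h.symm
  · intro T _
    simp

theorem mem_range_pentagonal_iff (n : ℕ) :
    n ∈ Set.range pentagonal ↔ IsSquare (24 * n + 1) := by
  constructor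
  · rintro ⟨k, rfl⟩
    have h := two_mul_natCast_pentagonal k
    refine ⟨(6 * k - 1).natAbs, ?_⟩
    zify
    rw [← abs_mul, abs_of_nonneg (mul_self_nonneg _)]
    linear_combination 12 * h
  · rintro ⟨x, hx⟩
    have hx6 : x % 6 = 1 ∨ x % 6 = 5 := by
      have h1 : (x * x) % 6 = 1 := by omega
      have h2 : x % 6 < 6 := Nat.mod_lt _ (by norm_num)
      rw [Nat.mul_mod] at h1
      interval_cases x % 6 <;> simp_all
    have : ∃ k : ℤ, (6 * k - 1) ^ 2 = (x : ℤ) ^ 2 := by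
      rcases hx6 with h | h
      · exact ⟨-(x / 6 : ℕ), by
          have : (x : ℤ) = 6 * (x / 6 : ℕ) + 1 := by omega
          rw [this]; push_cast; ring⟩
      · exact ⟨(x / 6 : ℕ) + 1, by
          have : (x : ℤ) = 6 * (x / 6 : ℕ) + 5 := by omega
          rw [this]; push_cast; ring⟩
    obtain ⟨k, hk⟩ := this
    refine ⟨k, ?_⟩
    have h := two_mul_natCast_pentagonal k
    zify at hx ⊢
    linarith

/-- The number of sets of distinct parts of `n` that contain `k`. -/
def countContaining (n k : ℕ) : ℕ := {T ∈ distinctSets n | k ∈ T}.card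

theorem countContaining_add {n k : ℕ} (hk : 0 < k) (hkn : k ≤ n) :
    countContaining n k + countContaining (n - k) k = (distinctSets (n - k)).card := by
  have h : countContaining n k = {T ∈ distinctSets (n - k) | k ∉ T}.card := by
    refine Finset.card_bij (fun T _ => T.erase k) ?_ ?_ ?_
    · intro T hT
      simp only [Finset.mem_filter, mem_distinctSets] at hT ⊢
      have := Finset.add_sum_erase T (fun i => i) hT.2
      refine ⟨⟨fun h0 => hT.1.1 (Finset.mem_of_mem_erase h0), by omega⟩, by simp⟩
    · intro T hT T' hT' h
      simp only [Finset.mem_filter] at hT hT'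
      rw [← Finset.insert_erase hT.2, ← Finset.insert_erase hT'.2, h]
    · intro T hT
      simp only [Finset.mem_filter, mem_distinctSets] at hT
      refine ⟨insert k T, ?_, Finset.erase_insert hT.2⟩
      simp only [Finset.mem_filter, mem_distinctSets, Finset.sum_insert hT.2, Finset.mem_insert]
      refine ⟨⟨?_, by omega⟩, by simp⟩
      rintro (h | h)
      · omega
      · exact hT.1.1 h
  rw [h, countContaining, add_comm, Finset.card_filter_add_card_filter_not]

theorem countContaining_mod_two {k : ℕ} (hk : 0 < k) (n : ℕ) :
    (countContaining n k : ZMod 2) =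
      ∑ m ∈ Finset.Icc 1 n with k ∣ m, ((distinctSets (n - m)).card : ZMod 2) := by
  induction n using Nat.strong_induction_on with
  | _ n ih =>
    rcases lt_or_ge n k with hn | hn
    · have h1 : countContaining n k = 0 := by
        rw [countContaining, Finset.card_eq_zero, Finset.filter_eq_empty_iff]
        intro T hT hkT
        have := Finset.mem_Icc.1 (Finset.mem_powerset.1 (Finset.mem_filter.1 hT).1 hkT)
        omega
      rw [h1, Finset.filter_eq_empty_iff.2]
      · simp
      · intro m hm hd
        have := Nat.le_of_dvd (by simp at hm; omega) hd
        simp at hm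
        omega
    · have h2 : {m ∈ Finset.Icc 1 n | k ∣ m} =
          insert k ({m ∈ Finset.Icc 1 (n - k) | k ∣ m}.map (addRightEmbedding k)) := by
        ext m
        simp only [Finset.mem_filter, Finset.mem_Icc, Finset.mem_insert, Finset.mem_map,
          addRightEmbedding_apply]
        constructor
        · rintro ⟨h, hd⟩
          by_cases hmk : m = k
          · exact Or.inl hmk
          · have := Nat.le_of_dvd (by omega) hd
            exact Or.inr ⟨m - k, ⟨by omega, Nat.dvd_sub hd dvd_rfl⟩, by omega⟩
        · rintro (rfl | ⟨a, ⟨h, hd⟩, rfl⟩)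
          · exact ⟨by omega, dvd_rfl⟩
          · exact ⟨by omega, hd.add dvd_rfl⟩
      rw [h2, Finset.sum_insert, Finset.sum_map]
      · have h3 := congrArg (Nat.cast : ℕ → ZMod 2) (countContaining_add hk hn)
        push_cast at h3
        rw [← h3, add_assoc, ih (n - k) (by omega)]
        simp only [addRightEmbedding_apply]
        simp_rw [Nat.sub_sub, add_comm k]
        rw [CharTwo.add_self_eq_zero, add_zero]
      · simp

theorem card_divisors_mod_two {m : ℕ} (hm : m ≠ 0) :
    (m.divisors.card : ZMod 2) = if IsSquare m then 1 else 0 := by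
  rw [← Finset.card_filter_add_card_filter_not (s := m.divisors) (fun d => d * d = m)]
  have h0 : (({d ∈ m.divisors | ¬ d * d = m}.card : ℕ) : ZMod 2) = 0 := by
    rw [Finset.card_eq_sum_ones, Nat.cast_sum]
    refine Finset.sum_involution (fun d _ => m / d) ?_ ?_ ?_ ?_
    · intros; decide
    · intro d hd _ h
      simp only [Finset.mem_filter, Nat.mem_divisors] at hd
      exact hd.2 (by nth_rw 1 [← h]; exact Nat.div_mul_cancel hd.1.1)
    · intro d hd
      simp only [Finset.mem_filter, Nat.mem_divisors] at hd ⊢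
      refine ⟨⟨Nat.div_dvd_of_dvd hd.1.1, hm⟩, fun h => hd.2 ?_⟩
      have h1 := Nat.div_mul_cancel hd.1.1
      have h2 : m / d ≠ 0 := by rintro h; simp [h] at h1; omega
      have h3 : m / d = d := Nat.eq_of_mul_eq_mul_left (Nat.pos_of_ne_zero h2) (h.trans h1.symm)
      rw [h3] at h1; exact h1
    · intro d hd
      simp only [Finset.mem_filter, Nat.mem_divisors] at hd
      exact Nat.div_div_self hd.1.1 hm
  rw [Nat.cast_add, h0, add_zero]
  split_ifs with h
  · obtain ⟨r, rfl⟩ := h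
    have : {d ∈ (r * r).divisors | d * d = r * r} = {r} := by
      ext d
      simp only [Finset.mem_filter, Nat.mem_divisors, Finset.mem_singleton, Nat.mul_self_inj]
      constructor
      · exact fun h => h.2
      · rintro rfl; exact ⟨⟨dvd_mul_right _ _, hm⟩, rfl⟩
    simp [this]
  · rw [Finset.filter_eq_empty_iff.2]
    · simp
    · intro d _ hd; exact h ⟨d, hd.symm⟩

/-- The pairs `(x, y)` with `x > 0`, `x + y ≡ 0 [ZMOD 5]` and `x ^ 2 + 24 * y ^ 2 = K`. -/
noncomputable def reprPairs (K : ℤ) : Finset (ℤ × ℤ) :=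
  {v ∈ Finset.Icc 1 K ×ˢ Finset.Icc (-K) K | 5 ∣ v.1 + v.2 ∧ v.1 ^ 2 + 24 * v.2 ^ 2 = K}

theorem mem_reprPairs {K x y : ℤ} :
    (x, y) ∈ reprPairs K ↔ 0 < x ∧ 5 ∣ x + y ∧ x ^ 2 + 24 * y ^ 2 = K := by
  simp only [reprPairs, Finset.mem_filter, Finset.mem_product, Finset.mem_Icc]
  refine ⟨fun h => ⟨by omega, h.2⟩, fun h => ⟨⟨⟨by omega, ?_⟩, ?_, ?_⟩, h.2⟩⟩ <;>
    nlinarith [sq_nonneg y, sq_nonneg (y - 1), sq_nonneg (y + 1), sq_nonneg (x - 1), h.2.2]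

/-- Multiplication by `(1 + √-24) / 5` followed by conjugation, normalised up to sign. -/
def reflect (v : ℤ × ℤ) : ℤ × ℤ :=
  if 0 < v.1 - 24 * v.2 then ((v.1 - 24 * v.2) / 5, -((v.1 + v.2) / 5))
  else (-((v.1 - 24 * v.2) / 5), (v.1 + v.2) / 5)

theorem card_reprPairs_mod_two {K : ℤ} (h2 : ¬ 2 ∣ K) (h3 : ¬ 3 ∣ K) :
    ((reprPairs K).card : ZMod 2) = 0 := by
  have hodd : ∀ x y : ℤ, x ^ 2 + 24 * y ^ 2 = K → ¬ 2 ∣ x ∧ ¬ 3 ∣ x := by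
    refine fun x y h => ⟨?_, ?_⟩
    · rintro ⟨a, rfl⟩; exact h2 ⟨2 * a ^ 2 + 12 * y ^ 2, by rw [← h]; ring⟩
    · rintro ⟨a, rfl⟩; exact h3 ⟨3 * a ^ 2 + 8 * y ^ 2, by rw [← h]; ring⟩
  rw [Finset.card_eq_sum_ones, Nat.cast_sum]
  refine Finset.sum_involution (fun v _ => reflect v) ?_ ?_ ?_ ?_
  · intros; decide
  · rintro ⟨x, y⟩ hv _ h
    rw [mem_reprPairs] at hv
    have := hodd x y hv.2.2
    simp only [reflect] at h
    split_ifs at h <;> simp only [Prod.mk.injEq] at h <;> omega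
  · rintro ⟨x, y⟩ hv
    rw [mem_reprPairs] at hv
    obtain ⟨hx, ⟨a, ha⟩, hK⟩ := hv
    have := hodd x y hK
    obtain rfl : y = 5 * a - x := by omega
    simp only [reflect]
    have e1 : (x - 24 * (5 * a - x)) / 5 = 5 * x - 24 * a := by omega
    have e2 : (x + (5 * a - x)) / 5 = a := by omega
    rw [e1, e2]
    split_ifs with h <;> rw [mem_reprPairs]
    · exact ⟨by omega, ⟨x - 5 * a, by ring⟩, by rw [← hK]; ring⟩
    · exact ⟨by omega, ⟨5 * a - x, by ring⟩, by rw [← hK]; ring⟩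
  · rintro ⟨x, y⟩ hv
    rw [mem_reprPairs] at hv
    obtain ⟨hx, ⟨a, ha⟩, hK⟩ := hv
    have := hodd x y hK
    obtain rfl : y = 5 * a - x := by omega
    have e1 : (x - 24 * (5 * a - x)) / 5 = 5 * x - 24 * a := by omega
    have e2 : (x + (5 * a - x)) / 5 = a := by omega
    simp only [reflect, e1, e2]
    split_ifs <;> simp only [Prod.mk.injEq] at * <;> omega

/-- The `m` in `[1, n]` that are squares and such that `n - m` is a pentagonal number. -/
def squarePentagonal (n : ℕ) : Finset ℕ :=
  {m ∈ Finset.Icc 1 n | IsSquare m ∧ IsSquare (24 * (n - m) + 1)}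

theorem card_squarePentagonal {n : ℕ} (h5 : 5 ∣ 24 * n + 1) (h25 : ¬ 25 ∣ 24 * n + 1) :
    (reprPairs (24 * n + 1)).card = (squarePentagonal n).card := by
  have hx5 : ∀ x y : ℤ, 5 ∣ x + y → x ^ 2 + 24 * y ^ 2 = 24 * n + 1 → ¬ 5 ∣ x := by
    rintro x y ⟨a, ha⟩ hK ⟨b, rfl⟩
    obtain rfl : y = 5 * (a - b) := by omega
    apply h25
    zify
    exact ⟨b ^ 2 + 24 * (a - b) ^ 2, by rw [← hK]; ring⟩
  have hy0 : ∀ x y : ℤ, 5 ∣ x + y → x ^ 2 + 24 * y ^ 2 = 24 * n + 1 → y ≠ 0 := by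
    rintro x y h hK rfl
    exact hx5 x 0 h hK (by simpa using h)
  refine Finset.card_bij (fun v _ => v.2.natAbs * v.2.natAbs) ?_ ?_ ?_
  · rintro ⟨x, y⟩ hv
    rw [mem_reprPairs] at hv
    have h0 := hy0 x y hv.2.1 hv.2.2
    simp only [squarePentagonal, Finset.mem_filter, Finset.mem_Icc]
    have hy : ((y.natAbs * y.natAbs : ℕ) : ℤ) = y ^ 2 := by
      rw [Int.natAbs_mul_self, sq]
    have hpos : 0 < y.natAbs * y.natAbs := by positivity
    have hle : y.natAbs * y.natAbs ≤ n := by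
      zify at *
      nlinarith [sq_nonneg x]
    refine ⟨⟨hpos, hle⟩, ⟨_, rfl⟩, ⟨x.natAbs, ?_⟩⟩
    have hx : ((x.natAbs * x.natAbs : ℕ) : ℤ) = x ^ 2 := by
      rw [Int.natAbs_mul_self, sq]
    have := hv.2.2
    omega
  · rintro ⟨x, y⟩ hv ⟨x', y'⟩ hv' h
    rw [mem_reprPairs] at hv hv'
    have hyy : y.natAbs = y'.natAbs := Nat.mul_self_inj.1 h
    have hy2 : y ^ 2 = y' ^ 2 := (Int.natAbs_eq_iff_sq_eq).1 hyy
    have hxx : x = x' := by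
      have : x ^ 2 = x' ^ 2 := by linarith [hv.2.2, hv'.2.2]
      exact (pow_left_inj₀ hv.1.le hv'.1.le two_ne_zero).1 this
    have := hx5 x y hv.2.1 hv.2.2
    have := hv.2.1
    have := hv'.2.1
    rw [Prod.mk.injEq]
    omega
  · intro m hm
    simp only [squarePentagonal, Finset.mem_filter, Finset.mem_Icc] at hm
    obtain ⟨⟨hm1, hmn⟩, ⟨y, rfl⟩, ⟨x, hx⟩⟩ := hm
    have hK : (x : ℤ) ^ 2 + 24 * (y : ℤ) ^ 2 = 24 * n + 1 := by
      zify [hmn] at hx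
      linarith
    have hxpos : (0 : ℤ) < x := by
      rcases Nat.eq_zero_or_pos x with rfl | h
      · simp at hx
      · exact_mod_cast h
    have hd : (5 : ℤ) ∣ (x + y) * (x - y) := by
      obtain ⟨c, hc⟩ := h5
      zify at hc
      exact ⟨c - 5 * y ^ 2, by linear_combination hK + hc⟩
    rcases (Int.prime_iff_natAbs_prime.2 (by norm_num : Nat.Prime (5 : ℤ).natAbs)).dvd_or_dvd hd
      with h | h
    · exact ⟨(x, y), mem_reprPairs.2 ⟨hxpos, h, hK⟩, by simp⟩
    · exact ⟨(x, -y), mem_reprPairs.2 ⟨hxpos, h, by rw [neg_sq, hK]⟩, by simp⟩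

theorem card_distinctSets_mod_two (n : ℕ) :
    ((distinctSets n).card : ZMod 2) = if IsSquare (24 * n + 1) then 1 else 0 := by
  have h := congrArg (Int.cast : ℤ → ZMod 2) (sum_neg_one_pow_card_distinctSets n)
  push_cast at h
  simp only [CharTwo.neg_eq, one_pow, Finset.sum_const, nsmul_eq_mul, mul_one] at h
  rw [h]
  split_ifs with hp <;> rw [← mem_range_pentagonal_iff] at hp
  · obtain ⟨k, rfl⟩ := hp
    rw [coeff_pentagonalSeries_pentagonal]
    rcases Int.even_or_odd k with hk | hk
    · simp [Int.negOnePow_even k hk]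
    · simp [Int.negOnePow_odd k hk]
  · simp [coeff_pentagonalSeries_eq_zero ℤ hp]

theorem sum_card_mod_two (n : ℕ) :
    ∑ T ∈ distinctSets n, (T.card : ZMod 2) = ((squarePentagonal n).card : ZMod 2) := by
  have h1 : ∑ T ∈ distinctSets n, (T.card : ZMod 2) =
      ∑ k ∈ Finset.Icc 1 n, (countContaining n k : ZMod 2) := by
    simp only [countContaining]
    norm_cast
    congr 1
    refine Eq.trans ?_
      (Finset.sum_card_bipartiteAbove_eq_sum_card_bipartiteBelow (fun k T => k ∈ T)).symm
    refine Finset.sum_congr rfl fun T hT => ?_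
    rw [Finset.bipartiteBelow, Finset.filter_mem_eq_inter, Finset.inter_eq_right.2]
    exact Finset.mem_powerset.1 (Finset.mem_filter.1 hT).1
  have h2 : ∀ m ∈ Finset.Icc 1 n, {k ∈ Finset.Icc 1 n | k ∣ m} = m.divisors := by
    intro m hm
    rw [Finset.mem_Icc] at hm
    ext k
    simp only [Finset.mem_filter, Finset.mem_Icc, Nat.mem_divisors]
    refine ⟨fun h => ⟨h.2, by omega⟩, fun h => ⟨⟨Nat.pos_of_dvd_of_pos h.1 (by omega), ?_⟩, h.1⟩⟩
    exact (Nat.le_of_dvd (by omega) h.1).trans hm.2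
  rw [h1, Finset.sum_congr rfl fun k hk => countContaining_mod_two (Finset.mem_Icc.1 hk).1 n]
  simp_rw [Finset.sum_filter]
  rw [Finset.sum_comm, squarePentagonal, Finset.card_filter, Nat.cast_sum]
  refine Finset.sum_congr rfl fun m hm => ?_
  rw [← Finset.sum_filter, h2 m hm, Finset.sum_const, nsmul_eq_mul,
    card_divisors_mod_two (by rw [Finset.mem_Icc] at hm; omega), card_distinctSets_mod_two]
  split_ifs <;> simp_all

theorem four_dvd_card_distinctSets {n : ℕ} (h5 : 5 ∣ 24 * n + 1) (h25 : ¬ 25 ∣ 24 * n + 1) :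
    (4 : ℤ) ∣ (distinctSets n).card := by
  have hsq : ¬ IsSquare (24 * n + 1) := by
    rintro ⟨x, hx⟩
    rw [hx] at h5 h25
    have : 5 ∣ x := by simpa using (Nat.Prime.dvd_mul (by norm_num : Nat.Prime 5)).1 h5
    exact h25 (mul_dvd_mul this this)
  have h0 : ∑ T ∈ distinctSets n, (-1 : ℤ) ^ T.card = 0 := by
    rw [sum_neg_one_pow_card_distinctSets, coeff_pentagonalSeries_eq_zero]
    rwa [mem_range_pentagonal_iff]
  have heven : ((∑ T ∈ distinctSets n, (T.card : ℤ) : ℤ) : ZMod 2) = 0 := by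
    push_cast
    rw [sum_card_mod_two, ← card_squarePentagonal h5 h25]
    exact card_reprPairs_mod_two (by omega) (by omega)
  rw [ZMod.intCast_zmod_eq_zero_iff_dvd] at heven
  have hmod : (4 : ℤ) ∣ ∑ T ∈ distinctSets n, (1 - (-1 : ℤ) ^ T.card - 2 * T.card) := by
    refine Finset.dvd_sum fun T _ => ?_
    rcases Nat.even_or_odd T.card with h | h
    · rw [h.neg_one_pow]; obtain ⟨a, ha⟩ := h; omega
    · rw [h.neg_one_pow]; obtain ⟨a, ha⟩ := h; omega
  rw [Finset.sum_sub_distrib, Finset.sum_sub_distrib, h0, ← Finset.mul_sum] at hmod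
  simp only [Finset.sum_const, nsmul_eq_mul, mul_one] at hmod
  push_cast at heven
  omega

theorem four_dvd_DSOME (n : ℕ) (h : (4 : ℤ) ∣ (distinctSets n).card) : (4 : ℤ) ∣ DSOME n := by
  have hmod : (4 : ℤ) ∣ DSOME n - ∑ _p ∈ Nat.Partition.distincts n, (n : ℤ) := by
    rw [DSOME, ← Finset.sum_sub_distrib]
    refine Finset.dvd_sum fun p _ => ?_
    have h1 := congrArg Multiset.sum (Multiset.filter_add_not (fun i => Even i) p.parts)
    simp only [Nat.not_even_iff_odd, Multiset.sum_add, p.parts_sum] at h1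
    have h2 : 2 ∣ (p.parts.filter (fun i => Even i)).sum :=
      Multiset.dvd_sum fun i hi => (Multiset.mem_filter.1 hi).2.two_dvd
    omega
  rw [Finset.sum_const, nsmul_eq_mul, card_distincts_eq] at hmod
  exact (dvd_iff_dvd_of_dvd_sub hmod).2 (h.mul_right _)

theorem DSOME_mod4 (n r : ℕ) (hr1 : 1 ≤ r) (hr4 : r ≤ 4) :
    DSOME (25 * n + 5 * r + 1) ≡ 0 [ZMOD 4] :=
  Int.modEq_zero_iff_dvd.2 <| four_dvd_DSOME _ <|
    four_dvd_card_distinctSets (by omega) (by omega)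
end

section
/- For every integer n ≥ 0 and every r with 1 ≤ r ≤ 4, DSOME(625n + 125r + 26) ≡ 0 (mod 8). -/
open PowerSeries

section Gauss

variable {R : Type*} [CommRing R]

theorem prod_Ico_one_sub_pow_succ_bot (q : R) {m n : ℕ} (h : m < n) :
    ∏ i ∈ Finset.Ico m n, (1 - q ^ (i + 1)) =
      (1 - q ^ (m + 1)) * ∏ i ∈ Finset.Ico (m + 1) n, (1 - q ^ (i + 1)) :=
  Finset.prod_eq_prod_Ico_succ_bot h _

/-- The partial sums of the remainder in the finite form of the Gauss square identity. -/
def gaussRemainder (q : R) (n m : ℕ) : R :=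
  ∑ s ∈ Finset.range m, (-1) ^ (s + 1) * q ^ ((s + 1) * (n + 1)) *
    (∏ i ∈ Finset.Ico (s + 1) n, (1 - q ^ (i + 1))) * ∏ i ∈ Finset.range s, (1 + q ^ (i + 1))

theorem gaussRemainder_succ_sub (q : R) {n m : ℕ} (h : m ≤ n) :
    gaussRemainder q (n + 1) m - (1 + q ^ (n + 1)) * gaussRemainder q n m =
      q ^ (n + 1) * ∏ i ∈ Finset.Ico 0 n, (1 - q ^ (i + 1)) -
        (-1) ^ m * q ^ ((n + 1) * (m + 1)) * (∏ i ∈ Finset.Ico m n, (1 - q ^ (i + 1))) *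
          ∏ i ∈ Finset.range m, (1 + q ^ (i + 1)) := by
  induction m with
  | zero => simp [gaussRemainder]
  | succ m ih =>
    have ih := ih (by omega)
    rw [prod_Ico_one_sub_pow_succ_bot q h] at ih
    simp only [gaussRemainder, Finset.sum_range_succ, Finset.prod_range_succ] at ih ⊢
    rw [Finset.prod_Ico_succ_top h]
    linear_combination ih

/-- A finite form of the Gauss identity `∑ (-1) ^ j q ^ (j ^ 2) = ∏ (1 - q ^ i) / (1 + q ^ i)`. -/
theorem prod_one_add_pow_mul_sum_sq (q : R) (n : ℕ) :
    (∏ i ∈ Finset.range n, (1 + q ^ (i + 1))) *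
        (1 + 2 * ∑ j ∈ Finset.range n, (-1) ^ (j + 1) * q ^ ((j + 1) ^ 2)) =
      ∏ i ∈ Finset.range n, (1 - q ^ (i + 1)) + 2 * gaussRemainder q n n := by
  induction n with
  | zero => simp [gaussRemainder]
  | succ n ih =>
    have h := gaussRemainder_succ_sub q le_rfl (n := n)
    rw [← Finset.range_eq_Ico, Finset.Ico_self, Finset.prod_empty] at h
    have h' : gaussRemainder q (n + 1) (n + 1) = gaussRemainder q (n + 1) n +
        (-1) ^ (n + 1) * q ^ ((n + 1) * (n + 1 + 1)) * ∏ i ∈ Finset.range n, (1 + q ^ (i + 1)) := by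
      simp [gaussRemainder, Finset.sum_range_succ]
    rw [h', Finset.prod_range_succ, Finset.prod_range_succ, Finset.sum_range_succ]
    linear_combination (1 + q ^ (n + 1)) * ih - 2 * h

theorem pow_succ_dvd_gaussRemainder (q : R) (n m : ℕ) : q ^ (n + 1) ∣ gaussRemainder q n m := by
  refine Finset.dvd_sum fun s _ => ?_
  refine Dvd.dvd.mul_right (Dvd.dvd.mul_right (Dvd.dvd.mul_left ?_ _) _) _
  exact pow_dvd_pow q (by nlinarith)

end Gauss

theorem prod_Icc_one_eq_prod_range {M : Type*} [CommMonoid M] (f : ℕ → M) (n : ℕ) :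
    ∏ i ∈ Finset.Icc 1 n, f i = ∏ i ∈ Finset.range n, f (i + 1) := by
  induction n with
  | zero => simp
  | succ n ih => rw [Finset.prod_Icc_succ_top (by omega), ih, Finset.prod_range_succ]

theorem sum_Icc_one_eq_sum_range {M : Type*} [AddCommMonoid M] (f : ℕ → M) (n : ℕ) :
    ∑ i ∈ Finset.Icc 1 n, f i = ∑ i ∈ Finset.range n, f (i + 1) := by
  induction n with
  | zero => simp
  | succ n ih => rw [Finset.sum_Icc_succ_top (by omega), ih, Finset.sum_range_succ]

theorem X_pow_dvd_prod_one_add_mul_sum_sq_sub (N : ℕ) :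
    (X : ℤ⟦X⟧) ^ (N + 1) ∣ (∏ i ∈ Finset.Icc 1 N, (1 + X ^ i)) *
      (1 + 2 * ∑ j ∈ Finset.Icc 1 N, (-1) ^ j * X ^ (j ^ 2)) - ∏ i ∈ Finset.Icc 1 N, (1 - X ^ i) := by
  rw [prod_Icc_one_eq_prod_range, prod_Icc_one_eq_prod_range, sum_Icc_one_eq_sum_range,
    prod_one_add_pow_mul_sum_sq, add_sub_cancel_left]
  exact Dvd.dvd.mul_left (pow_succ_dvd_gaussRemainder _ _ _) _

/-- The derivation `X d/dX`. -/
noncomputable def eulerDerivation (R : Type*) [CommRing R] : Derivation R R⟦X⟧ R⟦X⟧ :=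
  (X : R⟦X⟧) • d⁄dX R

theorem eulerDerivation_X_pow (n : ℕ) :
    eulerDerivation ℤ ((X : ℤ⟦X⟧) ^ n) = (n : ℤ⟦X⟧) * X ^ n := by
  rcases n with _ | n
  · simp
  · rw [eulerDerivation, Derivation.smul_apply, derivative_pow, derivative_X, smul_eq_mul,
      Nat.add_sub_cancel]
    ring

theorem X_pow_dvd_eulerDerivation {f : ℤ⟦X⟧} {n : ℕ} (h : X ^ n ∣ f) :
    X ^ n ∣ eulerDerivation ℤ f := by
  obtain ⟨g, rfl⟩ := h
  rw [Derivation.leibniz, eulerDerivation_X_pow]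
  exact ⟨eulerDerivation ℤ g + n * g, by simp only [smul_eq_mul]; ring⟩

theorem Derivation.map_finset_prod {ι R A : Type*} [DecidableEq ι] [CommRing R] [CommRing A]
    [Algebra R A] (D : Derivation R A A) (s : Finset ι) (f : ι → A) :
    D (∏ i ∈ s, f i) = ∑ k ∈ s, D (f k) * ∏ i ∈ s.erase k, f i := by
  induction s using Finset.induction_on with
  | empty => simp
  | insert a s ha ih =>
    rw [Finset.prod_insert ha, D.leibniz, ih, Finset.sum_insert ha, Finset.erase_insert ha,
      Finset.smul_sum, add_comm, smul_eq_mul, mul_comm]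
    congr 1
    refine Finset.sum_congr rfl fun k hk => ?_
    have hka : a ≠ k := fun h => ha (h ▸ hk)
    rw [Finset.erase_insert_of_ne hka, Finset.prod_insert (by simp [ha]), smul_eq_mul]
    ring

theorem sum_powerset_sum_mul_prod {ι R : Type*} [DecidableEq ι] [CommRing R] (s : Finset ι)
    (c x : ι → R) :
    ∑ t ∈ s.powerset, (∑ i ∈ t, c i) * ∏ i ∈ t, x i =
      ∑ k ∈ s, c k * x k * ∏ i ∈ s.erase k, (1 + x i) := by
  induction s using Finset.induction_on with
  | empty => simp
  | insert a s ha ih =>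
    have h : ∑ t ∈ s.powerset, (∑ i ∈ insert a t, c i) * ∏ i ∈ insert a t, x i =
        c a * x a * ∏ i ∈ s, (1 + x i) + x a * ∑ t ∈ s.powerset, (∑ i ∈ t, c i) * ∏ i ∈ t, x i := by
      rw [Finset.prod_one_add, Finset.mul_sum, Finset.mul_sum, ← Finset.sum_add_distrib]
      refine Finset.sum_congr rfl fun t ht => ?_
      have hat : a ∉ t := fun h => ha (Finset.mem_powerset.1 ht h)
      rw [Finset.sum_insert hat, Finset.prod_insert hat]
      ring
    rw [Finset.sum_powerset_insert ha, h, ih, Finset.sum_insert ha, Finset.erase_insert ha,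
      add_left_comm, Finset.mul_sum, ← Finset.sum_add_distrib]
    congr 1
    refine Finset.sum_congr rfl fun k hk => ?_
    have hka : a ≠ k := fun h => ha (h ▸ hk)
    rw [Finset.erase_insert_of_ne hka, Finset.prod_insert (by simp [ha])]
    ring

/-- The weight with which a part contributes to `DSOME`. -/
def signedPart (i : ℕ) : ℤ := if Odd i then i else -i

theorem multiset_filter_sum_sub (s : Multiset ℕ) :
    ((s.filter (fun i => Odd i)).sum : ℤ) - ((s.filter (fun i => Even i)).sum : ℤ) =
      (s.map signedPart).sum := by
  induction s using Multiset.induction_on with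
  | empty => simp
  | cons a s ih =>
    rcases Nat.even_or_odd a with h | h
    · have h' : ¬ Odd a := Nat.not_odd_iff_even.2 h
      simp [h, h', signedPart, ← ih]
      ring
    · have h' : ¬ Even a := Nat.not_even_iff_odd.2 h
      simp [h, h', signedPart, ← ih]
      ring

theorem DSOME_eq_sum_powerset {n N : ℕ} (h : n ≤ N) :
    DSOME n = ∑ t ∈ (Finset.Icc 1 N).powerset with ∑ i ∈ t, i = n, ∑ i ∈ t, signedPart i := by
  unfold DSOME
  refine Finset.sum_bij (fun p _ => p.parts.toFinset) ?_ ?_ ?_ ?_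
  · intro p hp
    have hnd : p.parts.Nodup := by simpa [Nat.Partition.distincts] using hp
    have hsum : ∑ i ∈ p.parts.toFinset, i = n := by
      rw [Finset.sum, Multiset.toFinset_val, hnd.dedup, Multiset.map_id', p.parts_sum]
    rw [Finset.mem_filter, Finset.mem_powerset]
    refine ⟨fun i hi => ?_, hsum⟩
    have hi' := Multiset.mem_toFinset.1 hi
    have : i ≤ n := p.parts_sum ▸ Multiset.le_sum_of_mem hi'
    have := p.parts_pos hi'
    rw [Finset.mem_Icc]
    omega
  · intro p hp p' hp' he
    have hnd : p.parts.Nodup := by simpa [Nat.Partition.distincts] using hp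
    have hnd' : p'.parts.Nodup := by simpa [Nat.Partition.distincts] using hp'
    have he' := congrArg Finset.val he
    rw [Multiset.toFinset_val, Multiset.toFinset_val, hnd.dedup, hnd'.dedup] at he'
    exact Nat.Partition.ext he'
  · intro t ht
    rw [Finset.mem_filter, Finset.mem_powerset] at ht
    refine ⟨⟨t.val, fun hi => (Finset.mem_Icc.1 (ht.1 hi)).1, ?_⟩, ?_, ?_⟩
    · rw [← ht.2, Finset.sum, Multiset.map_id']
    · simp [Nat.Partition.distincts, t.nodup]
    · simp
  · intro p hp
    have hnd : p.parts.Nodup := by simpa [Nat.Partition.distincts] using hp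
    rw [multiset_filter_sum_sub, Finset.sum, Multiset.toFinset_val, hnd.dedup]

/-- The generating series of `DSOME`, truncated to parts at most `N`. -/
noncomputable def truncDSOME (N : ℕ) : ℤ⟦X⟧ :=
  ∑ k ∈ Finset.Icc 1 N, (signedPart k : ℤ⟦X⟧) * X ^ k * ∏ i ∈ (Finset.Icc 1 N).erase k, (1 + X ^ i)

theorem coeff_truncDSOME {n N : ℕ} (h : n ≤ N) : coeff n (truncDSOME N) = DSOME n := by
  rw [DSOME_eq_sum_powerset h, truncDSOME, ← sum_powerset_sum_mul_prod, map_sum,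
    Finset.sum_filter]
  refine Finset.sum_congr rfl fun t _ => ?_
  rw [Finset.prod_pow_eq_pow_sum, ← Int.cast_sum, ← eq_intCast (C : ℤ →+* ℤ⟦X⟧), coeff_C_mul_X_pow]
  simp [eq_comm]

theorem eulerDerivation_prod_one_add (s : Finset ℕ) :
    eulerDerivation ℤ (∏ i ∈ s, (1 + X ^ i)) =
      ∑ k ∈ s, (k : ℤ⟦X⟧) * X ^ k * ∏ i ∈ s.erase k, (1 + X ^ i) := by
  simp [Derivation.map_finset_prod, eulerDerivation_X_pow, -Derivation.leibniz_pow]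

theorem eulerDerivation_prod_one_sub (s : Finset ℕ) :
    eulerDerivation ℤ (∏ i ∈ s, (1 - X ^ i)) =
      -∑ k ∈ s, (k : ℤ⟦X⟧) * X ^ k * ∏ i ∈ s.erase k, (1 - X ^ i) := by
  simp [Derivation.map_finset_prod, eulerDerivation_X_pow, -Derivation.leibniz_pow]

theorem truncDSOME_add_eulerDerivation (N : ℕ) :
    truncDSOME N + eulerDerivation ℤ (∏ i ∈ Finset.Icc 1 N, (1 + X ^ i)) =
      2 * ∑ k ∈ Finset.Icc 1 N with Odd k,
        (k : ℤ⟦X⟧) * X ^ k * ∏ i ∈ (Finset.Icc 1 N).erase k, (1 + X ^ i) := by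
  rw [eulerDerivation_prod_one_add, truncDSOME, ← Finset.sum_add_distrib, Finset.sum_filter,
    Finset.mul_sum]
  refine Finset.sum_congr rfl fun k _ => ?_
  by_cases h : Odd k
  · simp only [signedPart, h, if_true, Int.cast_natCast]
    ring
  · simp only [signedPart, h, if_false, Int.cast_neg, Int.cast_natCast]
    ring

/-- The ideal of power series that vanish modulo `m` up to degree `N`. -/
noncomputable def truncIdeal (m N : ℕ) : Ideal ℤ⟦X⟧ := Ideal.span {(m : ℤ⟦X⟧), X ^ (N + 1)}

theorem mem_truncIdeal_of_dvd_left {m N : ℕ} {f : ℤ⟦X⟧} (h : (m : ℤ⟦X⟧) ∣ f) :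
    f ∈ truncIdeal m N :=
  Ideal.mem_of_dvd _ h (Ideal.subset_span (by simp))

theorem mem_truncIdeal_of_dvd_right {m N : ℕ} {f : ℤ⟦X⟧} (h : X ^ (N + 1) ∣ f) :
    f ∈ truncIdeal m N :=
  Ideal.mem_of_dvd _ h (Ideal.subset_span (by simp))

theorem dvd_coeff_of_mem_truncIdeal {m N n : ℕ} {f : ℤ⟦X⟧} (h : f ∈ truncIdeal m N)
    (hn : n ≤ N) : (m : ℤ) ∣ coeff n f := by
  obtain ⟨a, b, rfl⟩ := Ideal.mem_span_pair.1 h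
  rw [map_add, coeff_mul_X_pow', if_neg (by omega), add_zero, mul_comm,
    ← map_natCast (C : ℤ →+* ℤ⟦X⟧), coeff_C_mul]
  exact dvd_mul_right _ _

theorem sum_even_Icc {M : Type*} [AddCommMonoid M] (f : ℕ → M) (N : ℕ) :
    ∑ k ∈ Finset.Icc 1 N with ¬ Odd k, f k = ∑ l ∈ Finset.Icc 1 N with 2 * l ≤ N, f (2 * l) := by
  symm
  refine Finset.sum_bij (fun l _ => 2 * l) ?_ ?_ ?_ ?_
  · intro l hl
    simp only [Finset.mem_filter, Finset.mem_Icc, Nat.not_odd_iff_even] at hl ⊢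
    exact ⟨by omega, even_two_mul l⟩
  · intro a _ b _ h
    omega
  · intro k hk
    simp only [Finset.mem_filter, Finset.mem_Icc, Nat.not_odd_iff_even] at hk
    obtain ⟨hk, l, rfl⟩ := hk
    exact ⟨l, by simp only [Finset.mem_filter, Finset.mem_Icc]; omega, by omega⟩
  · simp

theorem one_sub_X_pow_ne_zero {n : ℕ} (hn : n ≠ 0) : (1 - X ^ n : ℤ⟦X⟧) ≠ 0 := by
  intro h
  have := congrArg (constantCoeff (R := ℤ)) h
  simp [hn] at this

theorem logDeriv_congr_mem (N : ℕ) :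
    (∏ i ∈ Finset.Icc 1 N, (1 + X ^ i)) *
        ∑ k ∈ Finset.Icc 1 N, (k : ℤ⟦X⟧) * X ^ k * ∏ i ∈ (Finset.Icc 1 N).erase k, (1 - X ^ i) -
      (∏ i ∈ Finset.Icc 1 N, (1 - X ^ i)) * ∑ k ∈ Finset.Icc 1 N with Odd k,
        (k : ℤ⟦X⟧) * X ^ k * ∏ i ∈ (Finset.Icc 1 N).erase k, (1 + X ^ i) ∈ truncIdeal 4 N := by
  set A : ℤ⟦X⟧ := ∏ i ∈ Finset.Icc 1 N, (1 - X ^ i) with hA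
  set B : ℤ⟦X⟧ := ∏ i ∈ Finset.Icc 1 N, (1 + X ^ i) with hB
  set a : ℕ → ℤ⟦X⟧ := fun k => ∏ i ∈ (Finset.Icc 1 N).erase k, (1 - X ^ i) with ha
  set b : ℕ → ℤ⟦X⟧ := fun k => ∏ i ∈ (Finset.Icc 1 N).erase k, (1 + X ^ i) with hb
  have hAa : ∀ k ∈ Finset.Icc 1 N, A = (1 - X ^ k) * a k := fun k hk =>
    (Finset.mul_prod_erase _ _ hk).symm
  have hBb : ∀ k ∈ Finset.Icc 1 N, B = (1 + X ^ k) * b k := fun k hk =>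
    (Finset.mul_prod_erase _ _ hk).symm
  have h_eq : B * ∑ k ∈ Finset.Icc 1 N, (k : ℤ⟦X⟧) * X ^ k * a k -
        A * ∑ k ∈ Finset.Icc 1 N with Odd k, (k : ℤ⟦X⟧) * X ^ k * b k =
      ∑ k ∈ Finset.Icc 1 N, ((if Odd k then 2 * (k : ℤ⟦X⟧) * X ^ (2 * k) * (a k * b k) else 0) +
        if 2 * k ≤ N then 2 * (k : ℤ⟦X⟧) * X ^ (2 * k) * (B * a (2 * k)) else 0) := by
    rw [← Finset.sum_filter_add_sum_filter_not (Finset.Icc 1 N) (fun k => Odd k), sum_even_Icc,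
      Finset.sum_add_distrib, ← Finset.sum_filter, ← Finset.sum_filter, mul_add, add_sub_right_comm,
      Finset.mul_sum, Finset.mul_sum, Finset.mul_sum, ← Finset.sum_sub_distrib]
    congr 1
    · refine Finset.sum_congr rfl fun k hk => ?_
      have hk := (Finset.mem_filter.1 hk).1
      linear_combination (k : ℤ⟦X⟧) * X ^ k * a k * hBb k hk -
        (k : ℤ⟦X⟧) * X ^ k * b k * hAa k hk
    · refine Finset.sum_congr rfl fun k hk => ?_
      push_cast
      ring
  rw [h_eq]
  refine Ideal.sum_mem _ fun k hk => ?_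
  by_cases hkN : 2 * k ≤ N
  · rw [if_pos hkN]
    have hk1 := (Finset.mem_Icc.1 hk).1
    refine mem_truncIdeal_of_dvd_left ?_
    by_cases hodd : Odd k
    · have h : a k * b k = B * a (2 * k) := by
        refine mul_left_cancel₀ (one_sub_X_pow_ne_zero (n := 2 * k) (by omega)) ?_
        have h2k := hAa (2 * k) (Finset.mem_Icc.2 ⟨by omega, hkN⟩)
        calc (1 - X ^ (2 * k)) * (a k * b k) = ((1 - X ^ k) * a k) * ((1 + X ^ k) * b k) := by ring
          _ = A * B := by rw [← hAa k hk, ← hBb k hk]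
          _ = _ := by rw [h2k]; ring
      rw [if_pos hodd, h]
      exact ⟨(k : ℤ⟦X⟧) * X ^ (2 * k) * (B * a (2 * k)), by push_cast; ring⟩
    · obtain ⟨l, rfl⟩ := Nat.not_odd_iff_even.1 hodd
      rw [if_neg hodd]
      exact ⟨(l : ℤ⟦X⟧) * X ^ (2 * (l + l)) * (B * a (2 * (l + l))), by push_cast; ring⟩
  · rw [if_neg hkN, add_zero]
    split_ifs
    · refine mem_truncIdeal_of_dvd_right (Dvd.dvd.mul_right (Dvd.dvd.mul_left ?_ _) _)
      exact pow_dvd_pow _ (by omega)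
    · exact zero_mem _

theorem two_dvd_sum_sq_sub (s : Finset ℕ) :
    (2 : ℤ⟦X⟧) ∣ (∑ j ∈ s, (-1) ^ j * X ^ (j ^ 2)) ^ 2 - ∑ j ∈ s, X ^ (2 * j ^ 2) := by
  induction s using Finset.induction_on with
  | empty => simp
  | insert a s ha ih =>
    obtain ⟨u, hu⟩ := ih
    rw [Finset.sum_insert ha, Finset.sum_insert ha]
    refine ⟨u + (-1) ^ a * X ^ (a ^ 2) * ∑ j ∈ s, (-1) ^ j * X ^ (j ^ 2), ?_⟩
    have h : (((-1) ^ a) ^ 2 : ℤ⟦X⟧) = 1 := by rw [← pow_mul, mul_comm, pow_mul]; simp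
    linear_combination hu + X ^ (2 * a ^ 2) * h

theorem isUnit_prod_one_sub (N : ℕ) : IsUnit (∏ i ∈ Finset.Icc 1 N, (1 - X ^ i) : ℤ⟦X⟧) := by
  rw [isUnit_iff_constantCoeff, map_prod]
  rw [Finset.prod_eq_one]
  · exact isUnit_one
  · intro i hi
    have := (Finset.mem_Icc.1 hi).1
    simp [show i ≠ 0 by omega]

/-- Modulo `8`, the generating series of `DSOME` is a combination of binary theta series. -/
theorem truncDSOME_sub_mem (N : ℕ) {A S S' : ℤ⟦X⟧} (hA : A = ∏ i ∈ Finset.Icc 1 N, (1 - X ^ i))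
    (hS : S = ∑ j ∈ Finset.Icc 1 N, (-1) ^ j * X ^ (j ^ 2))
    (hS' : S' = ∑ j ∈ Finset.Icc 1 N, X ^ (2 * j ^ 2)) :
    truncDSOME N - (A * eulerDerivation ℤ (1 + 2 * S) - (1 + 2 * S) * eulerDerivation ℤ A -
      2 * eulerDerivation ℤ A + 4 * S' * eulerDerivation ℤ A) ∈ truncIdeal 8 N := by
  set B : ℤ⟦X⟧ := ∏ i ∈ Finset.Icc 1 N, (1 + X ^ i) with hB
  set W := truncDSOME N
  set D := eulerDerivation ℤ
  have hD2 : D (1 + 2 * S) = 2 * D S := by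
    rw [two_mul, map_add, map_add, Derivation.map_one_eq_zero, zero_add, two_mul]
  have h2 : B * (1 + 2 * S) - A ∈ truncIdeal 8 N := by
    rw [hA, hS]
    exact mem_truncIdeal_of_dvd_right (X_pow_dvd_prod_one_add_mul_sum_sq_sub N)
  have h3 : B * (2 * D S) + (1 + 2 * S) * D B - D A ∈ truncIdeal 8 N := by
    have h := X_pow_dvd_eulerDerivation (X_pow_dvd_prod_one_add_mul_sum_sq_sub N)
    rw [← hA, ← hS, ← hB, map_sub, Derivation.leibniz, smul_eq_mul, smul_eq_mul, hD2] at h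
    exact mem_truncIdeal_of_dvd_right h
  have h1 : A * (W + D B) + 2 * B * D A ∈ truncIdeal 8 N := by
    have h := logDeriv_congr_mem N
    rw [truncIdeal, Ideal.mem_span_pair] at h
    obtain ⟨u, v, huv⟩ := h
    rw [truncIdeal, Ideal.mem_span_pair]
    refine ⟨-u, -2 * v, ?_⟩
    have hDA := eulerDerivation_prod_one_sub (Finset.Icc 1 N)
    have hW := truncDSOME_add_eulerDerivation N
    rw [← hA] at huv hDA
    rw [← hB] at huv hW
    push_cast at huv ⊢
    linear_combination (-2) * huv - A * hW - 2 * B * hDA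
  obtain ⟨u, hu⟩ := two_dvd_sum_sq_sub (Finset.Icc 1 N)
  rw [← hS, ← hS'] at hu
  have k1 : (1 + 2 * S) * W + 3 * D A - 2 * B * D S ∈ truncIdeal 8 N := by
    obtain ⟨c, hc⟩ := isUnit_prod_one_sub N
    rw [← hA] at hc
    have hcinv : (↑c⁻¹ : ℤ⟦X⟧) * A = 1 := by rw [← hc]; simp
    have h := Ideal.mul_mem_left _ (↑c⁻¹ : ℤ⟦X⟧) (sub_mem (sub_mem
      (Ideal.mul_mem_left _ (1 + 2 * S) h1) (Ideal.mul_mem_left _ A h3))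
      (Ideal.mul_mem_left _ (2 * D A) h2))
    convert h using 1
    linear_combination (-((1 + 2 * S) * W + 3 * D A - 2 * B * D S)) * hcinv
  have k2 : (1 + 2 * S) ^ 2 * W + 3 * (1 + 2 * S) * D A - 2 * A * D S ∈ truncIdeal 8 N := by
    convert add_mem (Ideal.mul_mem_left _ (1 + 2 * S) k1) (Ideal.mul_mem_left _ (2 * D S) h2)
      using 1
    ring
  have k3 : (8 : ℤ⟦X⟧) * (2 * (S + S ^ 2) ^ 2 * W + D A * (S + 3 * S ^ 3 + 4 * S ^ 2 + u) -
      A * D S * (S + S ^ 2)) ∈ truncIdeal 8 N :=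
    mem_truncIdeal_of_dvd_left ⟨_, by push_cast; rfl⟩
  convert add_mem (Ideal.mul_mem_left _ (1 - 4 * (S + S ^ 2)) k2) k3 using 1
  rw [hD2]
  linear_combination 4 * D A * hu

/-- The integer points `(k, y)` with `k * (3 * k - 1) / 2 + y ^ 2 = N`. -/
noncomputable def pentagonalSquarePoints (N : ℤ) : Finset (ℤ × ℤ) :=
  (Finset.Icc (-N) N ×ˢ Finset.Icc (-N) N).filter
    fun z => z.1 * (3 * z.1 - 1) + 2 * z.2 ^ 2 = 2 * N

theorem mem_pentagonalSquarePoints {N : ℤ} {z : ℤ × ℤ} :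
    z ∈ pentagonalSquarePoints N ↔ z.1 * (3 * z.1 - 1) + 2 * z.2 ^ 2 = 2 * N := by
  obtain ⟨k, y⟩ := z
  simp only [pentagonalSquarePoints, Finset.mem_filter, Finset.mem_product, Finset.mem_Icc,
    and_iff_right_iff_imp]
  intro h
  have hy : |y| ≤ y ^ 2 := by
    rw [← sq_abs]; nlinarith [abs_nonneg y, Int.le_self_sq |y|]
  have hk : 2 * |k| ≤ k * (3 * k - 1) := by
    rcases le_or_gt k 0 with h0 | h0
    · rw [abs_of_nonpos h0]
      rcases h0.eq_or_lt with rfl | h0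
      · simp
      · nlinarith
    · rw [abs_of_pos h0]; nlinarith
  have := abs_le.1 (show |k| ≤ N by nlinarith [abs_nonneg y])
  have := abs_le.1 (show |y| ≤ N by nlinarith [abs_nonneg k])
  tauto

theorem five_dvd_sub_or_add {k b M : ℤ} (hM : M % 5 = 1)
    (h : k * (3 * k - 1) + 2 * b ^ 2 = 2 * M) :
    (5 : ℤ) ∣ (1 - 6 * k - b) * (1 - 6 * k + b) := by
  have : (1 - 6 * k - b) * (1 - 6 * k + b) = 24 * M + 1 - 25 * b ^ 2 := by linear_combination 12 * h
  omega

theorem mod_five_cases {k b M : ℤ} (hM : M % 5 = 1) (hM' : M % 25 ≠ 1)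
    (h : k * (3 * k - 1) + 2 * b ^ 2 = 2 * M) :
    b % 5 ≠ 0 ∧ ((k + b) % 5 = 1 ∧ (k - b) % 5 ≠ 1 ∨ (k + b) % 5 ≠ 1 ∧ (k - b) % 5 = 1) := by
  have h1 := five_dvd_sub_or_add hM h
  have hb : b % 5 ≠ 0 := by
    intro hb
    obtain ⟨c, rfl⟩ := Int.dvd_of_emod_eq_zero hb
    have h2 : (5 : ℤ) ∣ 1 - 6 * k := by
      rcases Int.Prime.dvd_mul' (by norm_num : Nat.Prime 5) h1 with h2 | h2 <;> push_cast at h2 <;>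
        omega
    obtain ⟨d, hd⟩ := h2
    have : 25 * (d ^ 2 + 24 * c ^ 2) = 24 * M + 1 := by
      linear_combination (-(1 - 6 * k + 5 * d)) * hd + 12 * h
    omega
  refine ⟨hb, ?_⟩
  rcases Int.Prime.dvd_mul' (by norm_num : Nat.Prime 5) h1 with h2 | h2 <;> push_cast at h2 <;>
    omega

/-- The residue classes modulo `5` of the points over some `N ≡ 1 [ZMOD 25]`. -/
theorem mod_five_cases_of_mod_twentyfive {k y N : ℤ} (hN : N % 25 = 1)
    (h : k * (3 * k - 1) + 2 * y ^ 2 = 2 * N) :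
    (y % 5 = 0 ∧ k % 5 = 1) ∨ (y % 5 ≠ 0 ∧ (k + y) % 5 = 1 ∧ (k - y) % 5 ≠ 1) ∨
      (y % 5 ≠ 0 ∧ (k + y) % 5 ≠ 1 ∧ (k - y) % 5 = 1) := by
  have h1 := five_dvd_sub_or_add (by omega) h
  rcases Int.Prime.dvd_mul' (by norm_num : Nat.Prime 5) h1 with h2 | h2 <;> push_cast at h2 <;>
    omega

theorem even_card_points {M : ℤ} :
    Even ((pentagonalSquarePoints M).filter fun z => (z.1 + z.2) % 5 = 1).card := by
  rw [even_iff_two_dvd, ← ZMod.natCast_eq_zero_iff, Finset.card_eq_sum_ones, Nat.cast_sum]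
  refine Finset.sum_involution
    (fun z _ => ((1 - z.1 + 4 * z.2) / 5, (z.2 - 1 + 6 * z.1) / 5)) ?_ ?_ ?_ ?_
  · intros; decide
  · rintro ⟨k, b⟩ hz _ he
    simp only [Finset.mem_filter, Prod.mk.injEq] at hz he
    omega
  · rintro ⟨k, b⟩ hz
    simp only [Finset.mem_filter, mem_pentagonalSquarePoints] at hz ⊢
    obtain ⟨h1, h2⟩ := hz
    obtain ⟨c, hc⟩ : ∃ c, c = (1 - k + 4 * b) / 5 := ⟨_, rfl⟩
    obtain ⟨d, hd⟩ : ∃ d, d = (b - 1 + 6 * k) / 5 := ⟨_, rfl⟩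
    rw [← hc, ← hd]
    have hkk : 5 * k = 1 - c + 4 * d := by omega
    have hbb : 5 * b = d - 1 + 6 * c := by omega
    refine ⟨?_, by omega⟩
    have : 25 * (k * (3 * k - 1) + 2 * b ^ 2) = 25 * (c * (3 * c - 1) + 2 * d ^ 2) := by
      linear_combination (3 * (5 * k + (1 - c + 4 * d)) - 5) * hkk +
        2 * (5 * b + (d - 1 + 6 * c)) * hbb
    linarith
  · rintro ⟨k, b⟩ hz
    simp only [Finset.mem_filter, Prod.mk.injEq] at hz ⊢
    omega

/-- The signed weight of a point. -/
def pointWeight (N : ℤ) (z : ℤ × ℤ) : ℤ := (z.1 + z.2).negOnePow * (2 * z.2 ^ 2 - N)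

theorem pointWeight_neg (N k y : ℤ) : pointWeight N (k, -y) = pointWeight N (k, y) := by
  have : (k + -y).negOnePow = (k + y).negOnePow := by
    rw [Int.negOnePow_eq_iff]; exact ⟨-y, by ring⟩
  simp [pointWeight, this]

theorem sum_filter_add_eq_sum_filter_sub (N : ℤ) :
    ∑ z ∈ (pentagonalSquarePoints N).filter (fun z => z.2 % 5 ≠ 0 ∧ (z.1 - z.2) % 5 = 1),
      pointWeight N z =
    ∑ z ∈ (pentagonalSquarePoints N).filter (fun z => z.2 % 5 ≠ 0 ∧ (z.1 + z.2) % 5 = 1),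
      pointWeight N z := by
  refine Finset.sum_nbij' (fun z => (z.1, -z.2)) (fun z => (z.1, -z.2)) ?_ ?_ ?_ ?_ ?_
  · rintro ⟨k, b⟩ hz
    simp only [Finset.mem_filter, mem_pentagonalSquarePoints, neg_sq] at hz ⊢
    refine ⟨hz.1, by omega, by omega⟩
  · rintro ⟨k, b⟩ hz
    simp only [Finset.mem_filter, mem_pentagonalSquarePoints, neg_sq] at hz ⊢
    refine ⟨hz.1, by omega, by omega⟩
  · simp
  · simp
  · simp [pointWeight_neg]

theorem sum_filter_five_dvd (M : ℤ) :
    ∑ z ∈ (pentagonalSquarePoints (25 * M + 1)).filter (fun z => z.2 % 5 = 0),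
      pointWeight (25 * M + 1) z =
    ∑ z ∈ pentagonalSquarePoints M, pointWeight (25 * M + 1) (1 - 5 * z.1, 5 * z.2) := by
  symm
  refine Finset.sum_nbij' (fun z => (1 - 5 * z.1, 5 * z.2)) (fun z => ((1 - z.1) / 5, z.2 / 5))
    ?_ ?_ ?_ ?_ ?_
  · rintro ⟨k, b⟩ hz
    simp only [Finset.mem_filter, mem_pentagonalSquarePoints] at hz ⊢
    exact ⟨by linear_combination 25 * hz, by omega⟩
  · rintro ⟨k, b⟩ hz
    simp only [Finset.mem_filter, mem_pentagonalSquarePoints] at hz ⊢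
    obtain ⟨h1, h2⟩ := hz
    have := mod_five_cases_of_mod_twentyfive (by omega) h1
    obtain ⟨c, rfl⟩ : ∃ c, b = 5 * c := ⟨b / 5, by omega⟩
    obtain ⟨d, rfl⟩ : ∃ d, k = 1 - 5 * d := ⟨(1 - k) / 5, by omega⟩
    rw [show (1 - (1 - 5 * d)) / 5 = d by omega, show 5 * c / 5 = c by omega]
    linarith
  · rintro ⟨k, b⟩ hz
    simp only [Prod.mk.injEq]
    omega
  · rintro ⟨k, b⟩ hz
    simp only [Finset.mem_filter, mem_pentagonalSquarePoints, Prod.mk.injEq] at hz ⊢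
    have := mod_five_cases_of_mod_twentyfive (by omega) hz.1
    omega
  · simp

theorem sum_filter_add {M : ℤ} (hM : M % 5 = 1) (hM' : M % 25 ≠ 1) :
    ∑ z ∈ (pentagonalSquarePoints (25 * M + 1)).filter
        (fun z => z.2 % 5 ≠ 0 ∧ (z.1 + z.2) % 5 = 1), pointWeight (25 * M + 1) z =
    ∑ z ∈ (pentagonalSquarePoints M).filter (fun z => (z.1 + z.2) % 5 = 1),
      pointWeight (25 * M + 1) (z.1 + 4 * z.2, z.2 + 1 - 6 * z.1) := by
  symm
  refine Finset.sum_nbij' (fun z => (z.1 + 4 * z.2, z.2 + 1 - 6 * z.1))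
    (fun z => (z.1 - 4 * ((z.2 - 1 + 6 * z.1) / 25), (z.2 - 1 + 6 * z.1) / 25)) ?_ ?_ ?_ ?_ ?_
  · rintro ⟨k, b⟩ hz
    simp only [Finset.mem_filter, mem_pentagonalSquarePoints] at hz ⊢
    have := mod_five_cases hM hM' hz.1
    exact ⟨by linear_combination 25 * hz.1, by omega, by omega⟩
  · rintro ⟨k, b⟩ hz
    simp only [Finset.mem_filter, mem_pentagonalSquarePoints] at hz ⊢
    obtain ⟨h1, h2, h3⟩ := hz
    have hd : (25 : ℤ) ∣ (1 - 6 * k - b) * (1 - 6 * k + b) := by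
      refine ⟨24 * M + 1 - b ^ 2, ?_⟩
      linear_combination 12 * h1
    have hcop : IsCoprime (25 : ℤ) (1 - 6 * k + b) := by
      rw [show (25 : ℤ) = 5 ^ 2 by norm_num]
      refine IsCoprime.pow_left ?_
      rw [Prime.coprime_iff_not_dvd (by norm_num)]
      omega
    obtain ⟨c, hc⟩ := hcop.dvd_of_dvd_mul_right hd
    obtain rfl : b = 1 - 6 * k - 25 * c := by linarith
    rw [show (1 - 6 * k - 25 * c - 1 + 6 * k) / 25 = -c by omega]
    have h4 : (k - 4 * -c) * (3 * (k - 4 * -c) - 1) + 2 * (-c) ^ 2 = 2 * M := by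
      have : 25 * ((k - 4 * -c) * (3 * (k - 4 * -c) - 1) + 2 * (-c) ^ 2) = 25 * (2 * M) := by
        linear_combination h1
      linarith
    have := mod_five_cases hM hM' h4
    exact ⟨h4, by omega⟩
  · rintro ⟨k, b⟩ hz
    simp only [Prod.mk.injEq]
    omega
  · rintro ⟨k, b⟩ hz
    simp only [Finset.mem_filter, mem_pentagonalSquarePoints, Prod.mk.injEq] at hz ⊢
    obtain ⟨h1, h2, h3⟩ := hz
    have hd : (25 : ℤ) ∣ (1 - 6 * k - b) * (1 - 6 * k + b) := by
      refine ⟨24 * M + 1 - b ^ 2, ?_⟩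
      linear_combination 12 * h1
    have hcop : IsCoprime (25 : ℤ) (1 - 6 * k + b) := by
      rw [show (25 : ℤ) = 5 ^ 2 by norm_num]
      refine IsCoprime.pow_left ?_
      rw [Prime.coprime_iff_not_dvd (by norm_num)]
      omega
    have := hcop.dvd_of_dvd_mul_right hd
    omega
  · simp

theorem four_dvd_pointWeight_add (M k b : ℤ) :
    (4 : ℤ) ∣ pointWeight (25 * M + 1) (1 - 5 * k, 5 * b) +
      pointWeight (25 * M + 1) (k + 4 * b, b + 1 - 6 * k) - 2 * M := by
  have h1 : (1 - 5 * k + 5 * b).negOnePow = (k + b + 1).negOnePow := by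
    rw [Int.negOnePow_eq_iff]; exact ⟨2 * b - 3 * k, by ring⟩
  have h2 : (k + 4 * b + (b + 1 - 6 * k)).negOnePow = (k + b + 1).negOnePow := by
    rw [Int.negOnePow_eq_iff]; exact ⟨2 * b - 3 * k, by ring⟩
  simp only [pointWeight, h1, h2]
  rcases Int.even_or_odd (k + b + 1) with h | h
  · rw [Int.negOnePow_even _ h]
    refine ⟨13 * b ^ 2 + b + 18 * k ^ 2 - 6 * b * k - 6 * k - 13 * M, ?_⟩
    push_cast
    ring
  · rw [Int.negOnePow_odd _ h]
    refine ⟨-(13 * b ^ 2 + b + 18 * k ^ 2 - 6 * b * k - 6 * k) + 12 * M, ?_⟩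
    push_cast
    ring

theorem eight_dvd_sum_pointWeight {M : ℤ} (hM : M % 5 = 1) (hM' : M % 25 ≠ 1) :
    (8 : ℤ) ∣ ∑ z ∈ pentagonalSquarePoints (25 * M + 1), pointWeight (25 * M + 1) z := by
  have h_refl : ∑ z ∈ (pentagonalSquarePoints M).filter (fun z => ¬ (z.1 + z.2) % 5 = 1),
        pointWeight (25 * M + 1) (1 - 5 * z.1, 5 * z.2) =
      ∑ z ∈ (pentagonalSquarePoints M).filter (fun z => (z.1 + z.2) % 5 = 1),
        pointWeight (25 * M + 1) (1 - 5 * z.1, 5 * z.2) := by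
    refine Finset.sum_nbij' (fun z => (z.1, -z.2)) (fun z => (z.1, -z.2)) ?_ ?_ ?_ ?_ ?_
    · rintro ⟨k, b⟩ hz
      simp only [Finset.mem_filter, mem_pentagonalSquarePoints, neg_sq] at hz ⊢
      have := mod_five_cases hM hM' hz.1
      exact ⟨hz.1, by omega⟩
    · rintro ⟨k, b⟩ hz
      simp only [Finset.mem_filter, mem_pentagonalSquarePoints, neg_sq] at hz ⊢
      have := mod_five_cases hM hM' hz.1
      exact ⟨hz.1, by omega⟩
    · simp
    · simp
    · simp [pointWeight_neg]
  have h_split : ∑ z ∈ (pentagonalSquarePoints (25 * M + 1)).filter (fun z => ¬ z.2 % 5 = 0),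
        pointWeight (25 * M + 1) z =
      2 * ∑ z ∈ (pentagonalSquarePoints (25 * M + 1)).filter
        (fun z => z.2 % 5 ≠ 0 ∧ (z.1 + z.2) % 5 = 1), pointWeight (25 * M + 1) z := by
    rw [two_mul]
    nth_rewrite 2 [← sum_filter_add_eq_sum_filter_sub]
    rw [← Finset.sum_filter_add_sum_filter_not _ (fun z => (z.1 + z.2) % 5 = 1),
      Finset.filter_filter, Finset.filter_filter]
    congr 1
    refine Finset.sum_congr (Finset.filter_congr ?_) fun _ _ => rfl
    rintro ⟨k, b⟩ hz
    have := mod_five_cases_of_mod_twentyfive (by omega) (mem_pentagonalSquarePoints.1 hz)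
    dsimp only at this ⊢
    omega
  rw [← Finset.sum_filter_add_sum_filter_not _ (fun z : ℤ × ℤ => z.2 % 5 = 0), h_split,
    sum_filter_five_dvd, sum_filter_add hM hM',
    ← Finset.sum_filter_add_sum_filter_not (pentagonalSquarePoints M)
      (fun z => (z.1 + z.2) % 5 = 1), h_refl, ← two_mul, ← mul_add, ← Finset.sum_add_distrib,
    show (8 : ℤ) = 2 * 4 by norm_num]
  refine mul_dvd_mul_left 2 ?_
  have h_four := Finset.dvd_sum fun z (_ : z ∈ (pentagonalSquarePoints M).filter
    fun z => (z.1 + z.2) % 5 = 1) => four_dvd_pointWeight_add M z.1 z.2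
  rw [Finset.sum_sub_distrib, Finset.sum_const, nsmul_eq_mul] at h_four
  refine (dvd_sub_left ?_).1 h_four
  obtain ⟨c, hc⟩ := even_card_points (M := M)
  exact ⟨c * M, by rw [hc]; push_cast; ring⟩

theorem no_pentagonal_add_two_sq {M : ℤ} (hM : M % 5 = 1) (hM' : M % 25 ≠ 1) (k y : ℤ) :
    k * (3 * k - 1) + 4 * y ^ 2 ≠ 2 * (25 * M + 1) := by
  intro h
  have aux : ∀ x y m : ℤ, x ^ 2 + 48 * y ^ 2 = 5 * m → ∃ x' y', x = 5 * x' ∧ y = 5 * y' := by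
    intro x y m h
    have : x % 5 = 0 ∧ y % 5 = 0 := by
      have h' : (x ^ 2 + 48 * y ^ 2) % 5 = 0 := by omega
      have hx : x % 5 = 0 ∨ x % 5 = 1 ∨ x % 5 = 2 ∨ x % 5 = 3 ∨ x % 5 = 4 := by omega
      have hy : y % 5 = 0 ∨ y % 5 = 1 ∨ y % 5 = 2 ∨ y % 5 = 3 ∨ y % 5 = 4 := by omega
      rcases hx with hx | hx | hx | hx | hx <;> rcases hy with hy | hy | hy | hy | hy <;>
        simp [pow_two, Int.add_emod, Int.mul_emod, hx, hy] at h' ⊢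
    exact ⟨x / 5, y / 5, by omega, by omega⟩
  obtain ⟨m, hm⟩ : ∃ m, 24 * M + 1 = 5 * m := ⟨(24 * M + 1) / 5, by omega⟩
  obtain ⟨x, y, hx, rfl⟩ := aux (1 - 6 * k) y (25 * m) (by linear_combination 12 * h + 25 * hm)
  have h2 : x ^ 2 + 48 * y ^ 2 = 5 * m := by
    have : 25 * (x ^ 2 + 48 * y ^ 2) = 25 * (5 * m) := by
      linear_combination 12 * h + 25 * hm - (1 - 6 * k + 5 * x) * hx
    linarith
  obtain ⟨x', y', rfl, rfl⟩ := aux x y m h2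
  have : 5 * (x' ^ 2 + 48 * y' ^ 2) = m := by linarith
  omega

theorem coeff_prod_one_sub_X_pow_eq {n N : ℕ} (hn : n ≤ N) (M : ℕ) (hM : N ≤ M) :
    coeff n (∏ i ∈ Finset.range M, (1 - X ^ (i + 1)) : ℤ⟦X⟧) =
      coeff n (∏ i ∈ Finset.range N, (1 - X ^ (i + 1)) : ℤ⟦X⟧) := by
  induction M, hM using Nat.le_induction with
  | base => rfl
  | succ M hM ih =>
    rw [Finset.prod_range_succ, mul_sub, mul_one, map_sub, coeff_mul_X_pow', if_neg (by omega), ih,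
      sub_zero]

open PowerSeries.WithPiTopology in
theorem coeff_prod_one_sub_X_pow {n N : ℕ} (hn : n ≤ N) :
    coeff n (∏ i ∈ Finset.Icc 1 N, (1 - X ^ i) : ℤ⟦X⟧) = coeff n (pentagonalSeries ℤ) := by
  have h := ((continuous_coeff ℤ n).tendsto _).comp (hasProd_one_sub_X_pow ℤ).tendsto_prod_nat
  rw [prod_Icc_one_eq_prod_range]
  refine tendsto_nhds_unique (tendsto_const_nhds.congr' ?_) h
  filter_upwards [Filter.eventually_ge_atTop N] with M hM
  exact (coeff_prod_one_sub_X_pow_eq hn M hM).symm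

/-- The pentagonal number series, truncated to indices of absolute value at most `N`. -/
noncomputable def truncPentagonal (N : ℕ) : ℤ⟦X⟧ :=
  ∑ k ∈ Finset.Icc (-N : ℤ) N, ((k.negOnePow : ℤ) : ℤ⟦X⟧) * X ^ pentagonal k

theorem coeff_intCast_mul_X_pow (n m : ℕ) (c : ℤ) :
    coeff n ((c : ℤ⟦X⟧) * X ^ m) = if n = m then c else 0 := by
  rw [← eq_intCast (C : ℤ →+* ℤ⟦X⟧), coeff_C_mul_X_pow]

theorem abs_le_pentagonal (k : ℤ) : |k| ≤ pentagonal k := by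
  have h := two_mul_natCast_pentagonal k
  rcases le_or_gt k 0 with h0 | h0
  · rw [abs_of_nonpos h0]
    rcases h0.eq_or_lt with rfl | h0
    · simp
    · nlinarith
  · rw [abs_of_pos h0]
    nlinarith

theorem coeff_truncPentagonal {n N : ℕ} (hn : n ≤ N) :
    coeff n (truncPentagonal N) = coeff n (pentagonalSeries ℤ) := by
  simp only [truncPentagonal, map_sum, coeff_intCast_mul_X_pow]
  by_cases h : n ∈ Set.range pentagonal
  · obtain ⟨k, rfl⟩ := h
    rw [coeff_pentagonalSeries_pentagonal, Finset.sum_eq_single k]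
    · rw [if_pos rfl, Int.cast_id]
    · intro l _ hl
      rw [if_neg fun h => hl (pentagonal_injective h).symm]
    · intro hk
      have := abs_le.1 (abs_le_pentagonal k)
      exact absurd (Finset.mem_Icc.2 ⟨by omega, by omega⟩) hk
  · rw [coeff_pentagonalSeries_eq_zero ℤ h]
    exact Finset.sum_eq_zero fun k _ => if_neg fun hk => h ⟨k, hk.symm⟩

theorem X_pow_dvd_prod_sub_truncPentagonal (N : ℕ) :
    (X : ℤ⟦X⟧) ^ (N + 1) ∣ ∏ i ∈ Finset.Icc 1 N, (1 - X ^ i) - truncPentagonal N := by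
  refine X_pow_dvd_iff.2 fun n hn => ?_
  rw [map_sub, coeff_prod_one_sub_X_pow (by omega), coeff_truncPentagonal (by omega), sub_self]

theorem one_add_two_mul_sum_sq (N : ℕ) :
    (1 + 2 * ∑ j ∈ Finset.Icc 1 N, (-1) ^ j * X ^ (j ^ 2) : ℤ⟦X⟧) =
      ∑ y ∈ Finset.Icc (-N : ℤ) N, ((y.negOnePow : ℤ) : ℤ⟦X⟧) * X ^ (y.natAbs ^ 2) := by
  induction N with
  | zero => simp
  | succ N ih =>
    have h : Finset.Icc (-(N + 1 : ℕ) : ℤ) (N + 1 : ℕ) =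
        insert (-(N + 1 : ℕ) : ℤ) (insert ((N + 1 : ℕ) : ℤ) (Finset.Icc (-N : ℤ) N)) := by
      ext y
      simp only [Finset.mem_insert, Finset.mem_Icc]
      omega
    rw [Finset.sum_Icc_succ_top (by omega), h, Finset.sum_insert, Finset.sum_insert, ← ih,
      Int.negOnePow_neg, Int.natAbs_neg, Int.natAbs_natCast, Int.coe_negOnePow_natCast]
    · push_cast
      ring
    · simp only [Finset.mem_Icc]
      omega
    · simp only [Finset.mem_insert, Finset.mem_Icc]
      omega

theorem eulerDerivation_intCast_mul_X_pow (c : ℤ) (n : ℕ) :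
    eulerDerivation ℤ ((c : ℤ⟦X⟧) * X ^ n) = (c : ℤ⟦X⟧) * ((n : ℤ⟦X⟧) * X ^ n) := by
  rw [Derivation.leibniz, Derivation.map_intCast, eulerDerivation_X_pow, smul_zero, add_zero,
    smul_eq_mul]

theorem eulerDerivation_truncPentagonal (N : ℕ) :
    eulerDerivation ℤ (truncPentagonal N) = ∑ k ∈ Finset.Icc (-N : ℤ) N,
      ((k.negOnePow * pentagonal k : ℤ) : ℤ⟦X⟧) * X ^ pentagonal k := by
  rw [truncPentagonal, map_sum]
  refine Finset.sum_congr rfl fun k _ => ?_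
  rw [eulerDerivation_intCast_mul_X_pow]
  push_cast
  ring

theorem coeff_theta_bracket (N : ℕ) :
    coeff N (truncPentagonal N *
        eulerDerivation ℤ (1 + 2 * ∑ j ∈ Finset.Icc 1 N, (-1) ^ j * X ^ (j ^ 2)) -
      (1 + 2 * ∑ j ∈ Finset.Icc 1 N, (-1) ^ j * X ^ (j ^ 2)) *
        eulerDerivation ℤ (truncPentagonal N)) =
    ∑ z ∈ pentagonalSquarePoints N, pointWeight N z := by
  rw [one_add_two_mul_sum_sq, map_sum, eulerDerivation_truncPentagonal, truncPentagonal,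
    Finset.sum_mul_sum, mul_comm, Finset.sum_mul_sum, ← Finset.sum_sub_distrib, map_sum,
    pentagonalSquarePoints, Finset.sum_filter, Finset.sum_product]
  refine Finset.sum_congr rfl fun k _ => ?_
  rw [← Finset.sum_sub_distrib, map_sum]
  refine Finset.sum_congr rfl fun y _ => ?_
  have hk := two_mul_natCast_pentagonal k
  have hy : ((y.natAbs ^ 2 : ℕ) : ℤ) = y ^ 2 := by simp
  generalize y.natAbs ^ 2 = m at hy ⊢
  have h : ((k.negOnePow : ℤ) : ℤ⟦X⟧) * X ^ pentagonal k *
        eulerDerivation ℤ (((y.negOnePow : ℤ) : ℤ⟦X⟧) * X ^ m) -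
      ((k.negOnePow * pentagonal k : ℤ) : ℤ⟦X⟧) * X ^ pentagonal k *
        (((y.negOnePow : ℤ) : ℤ⟦X⟧) * X ^ m) =
      ((k.negOnePow * y.negOnePow * (m - pentagonal k) : ℤ) : ℤ⟦X⟧) * X ^ (pentagonal k + m) := by
    rw [eulerDerivation_intCast_mul_X_pow]
    push_cast
    ring
  rw [h, coeff_intCast_mul_X_pow]
  by_cases hz : k * (3 * k - 1) + 2 * y ^ 2 = 2 * (N : ℤ)
  · have hp : (pentagonal k : ℤ) = N - m := by linarith
    rw [if_pos (by omega), if_pos hz, pointWeight, Int.negOnePow_add, Units.val_mul, hp, hy]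
    ring
  · rw [if_neg fun h => hz (by rw [← hk, ← hy]; omega), if_neg hz]

theorem coeff_eulerDerivation_truncPentagonal_eq_zero {N : ℕ}
    (hN : ∀ k : ℤ, k * (3 * k - 1) ≠ 2 * N) :
    coeff N (eulerDerivation ℤ (truncPentagonal N)) = 0 := by
  rw [eulerDerivation_truncPentagonal, map_sum]
  refine Finset.sum_eq_zero fun k _ => ?_
  rw [coeff_intCast_mul_X_pow, if_neg]
  intro h
  exact hN k (by rw [← two_mul_natCast_pentagonal, h])

theorem coeff_sum_mul_eulerDerivation_truncPentagonal_eq_zero {N : ℕ}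
    (hN : ∀ k y : ℤ, k * (3 * k - 1) + 4 * y ^ 2 ≠ 2 * N) :
    coeff N ((∑ j ∈ Finset.Icc 1 N, X ^ (2 * j ^ 2)) *
      eulerDerivation ℤ (truncPentagonal N)) = 0 := by
  rw [eulerDerivation_truncPentagonal, Finset.sum_mul_sum, map_sum]
  refine Finset.sum_eq_zero fun j _ => ?_
  rw [map_sum]
  refine Finset.sum_eq_zero fun k _ => ?_
  rw [mul_left_comm, ← pow_add, coeff_intCast_mul_X_pow, if_neg]
  intro h
  refine hN k j ?_
  rw [← two_mul_natCast_pentagonal, h]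
  push_cast
  ring

theorem DSOME_modEq_sum_pointWeight {N : ℕ}
    (hN : ∀ k y : ℤ, k * (3 * k - 1) + 4 * y ^ 2 ≠ 2 * N) :
    DSOME N ≡ ∑ z ∈ pentagonalSquarePoints N, pointWeight N z [ZMOD 8] := by
  set S : ℤ⟦X⟧ := ∑ j ∈ Finset.Icc 1 N, (-1) ^ j * X ^ (j ^ 2) with hS
  set S' : ℤ⟦X⟧ := ∑ j ∈ Finset.Icc 1 N, X ^ (2 * j ^ 2) with hS'
  set A : ℤ⟦X⟧ := ∏ i ∈ Finset.Icc 1 N, (1 - X ^ i) with hA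
  set P := truncPentagonal N with hP
  have h := truncDSOME_sub_mem N hA hS hS'
  have hAP : A - P ∈ truncIdeal 8 N :=
    mem_truncIdeal_of_dvd_right (X_pow_dvd_prod_sub_truncPentagonal N)
  have hDAP : eulerDerivation ℤ A - eulerDerivation ℤ P ∈ truncIdeal 8 N := by
    rw [← map_sub]
    exact mem_truncIdeal_of_dvd_right
      (X_pow_dvd_eulerDerivation (X_pow_dvd_prod_sub_truncPentagonal N))
  have h' : truncDSOME N - (P * eulerDerivation ℤ (1 + 2 * S) - (1 + 2 * S) * eulerDerivation ℤ P) +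
      ((2 : ℤ) : ℤ⟦X⟧) * eulerDerivation ℤ P - ((4 : ℤ) : ℤ⟦X⟧) * (S' * eulerDerivation ℤ P) ∈
      truncIdeal 8 N := by
    convert add_mem (add_mem h (Ideal.mul_mem_left _ (eulerDerivation ℤ (1 + 2 * S)) hAP))
      (Ideal.mul_mem_left _ (-(1 + 2 * S) - 2 + 4 * S') hDAP) using 1
    push_cast
    ring
  have h8 := dvd_coeff_of_mem_truncIdeal h' le_rfl
  rw [map_sub, map_add, map_sub, coeff_truncDSOME le_rfl, coeff_theta_bracket,
    ← eq_intCast (C : ℤ →+* ℤ⟦X⟧), ← eq_intCast (C : ℤ →+* ℤ⟦X⟧), coeff_C_mul, coeff_C_mul,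
    coeff_sum_mul_eulerDerivation_truncPentagonal_eq_zero hN,
    coeff_eulerDerivation_truncPentagonal_eq_zero fun k => by simpa using hN k 0, mul_zero,
    mul_zero, add_zero, sub_zero] at h8
  exact (Int.modEq_iff_dvd.2 h8).symm

theorem DSOME_mod8 (n r : ℕ) (hr1 : 1 ≤ r) (hr4 : r ≤ 4) :
    DSOME (625 * n + 125 * r + 26) ≡ 0 [ZMOD 8] := by
  obtain ⟨M, hM⟩ : ∃ M : ℤ, M = 25 * n + 5 * r + 1 := ⟨_, rfl⟩
  have hN : ((625 * n + 125 * r + 26 : ℕ) : ℤ) = 25 * M + 1 := by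
    rw [hM]
    push_cast
    ring
  have h1 : M % 5 = 1 := by omega
  have h2 : M % 25 ≠ 1 := by omega
  refine (DSOME_modEq_sum_pointWeight fun k y => ?_).trans ?_
  · rw [hN]
    exact no_pentagonal_add_two_sq h1 h2 k y
  · rw [hN, Int.modEq_zero_iff_dvd]
    exact eight_dvd_sum_pointWeight h1 h2
end

section
/- For every integer n ≥ 0 and every r with 1 ≤ r ≤ 4, DSOME(15625n + 3125r + 651) ≡ 5·DSOME(25n + 5r + 1) + DSOME(625n + 125r + 26) (mod 8). -/
open PowerSeries

theorem gauss_telescope {R : Type*} [CommRing R] (q : R) (n t : ℕ) (ht : t ≤ n) :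
    q ^ (n + 1) * ∏ i ∈ Finset.range n, (1 - q ^ (i + 1)) +
      ∑ s ∈ Finset.range t,
        ((1 + q ^ (n + 1)) * ((-1) ^ (s + 1) * q ^ ((s + 1) * (n + 1)) *
            (∏ i ∈ Finset.range s, (1 + q ^ (i + 1))) *
            ∏ i ∈ Finset.Ico (s + 1) n, (1 - q ^ (i + 1))) -
          (-1) ^ (s + 1) * q ^ ((s + 1) * (n + 2)) *
            (∏ i ∈ Finset.range s, (1 + q ^ (i + 1))) *
            ∏ i ∈ Finset.Ico (s + 1) (n + 1), (1 - q ^ (i + 1))) =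
      (-1) ^ t * q ^ ((n + 1) * (t + 1)) * (∏ i ∈ Finset.range t, (1 + q ^ (i + 1))) *
        ∏ i ∈ Finset.Ico t n, (1 - q ^ (i + 1)) := by
  induction t with
  | zero =>
    rw [Finset.sum_range_zero, Finset.prod_range_zero, Nat.Ico_zero_eq_range]
    ring
  | succ t ih =>
    rw [Finset.sum_range_succ, ← add_assoc, ih (by omega),
      Finset.prod_Ico_succ_top (show t + 1 ≤ n by omega),
      Finset.prod_eq_prod_Ico_succ_bot (show t < n by omega),
      Finset.prod_range_succ]
    ring

theorem finite_gauss {R : Type*} [CommRing R] (q : R) (n : ℕ) :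
    (∏ i ∈ Finset.range n, (1 + q ^ (i + 1))) *
        (1 + 2 * ∑ s ∈ Finset.range n, (-1) ^ (s + 1) * q ^ ((s + 1) ^ 2)) =
      ∏ i ∈ Finset.range n, (1 - q ^ (i + 1)) +
        2 * ∑ s ∈ Finset.range n, (-1) ^ (s + 1) * q ^ ((s + 1) * (n + 1)) *
          (∏ i ∈ Finset.range s, (1 + q ^ (i + 1))) *
          ∏ i ∈ Finset.Ico (s + 1) n, (1 - q ^ (i + 1)) := by
  induction n with
  | zero => simp
  | succ n ih =>
    have h := gauss_telescope q n n le_rfl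
    rw [Finset.sum_sub_distrib, ← Finset.mul_sum] at h
    simp only [Finset.Ico_self, Finset.prod_empty, mul_one] at h
    rw [Finset.sum_range_succ, Finset.sum_range_succ _ n, Finset.prod_range_succ,
      Finset.prod_range_succ _ n]
    simp only [Finset.Ico_self, Finset.prod_empty, mul_one]
    linear_combination (1 + q ^ (n + 1)) * ih + 2 * h

open scoped PowerSeries.WithPiTopology

/-- The generating function of partitions into distinct parts. -/
noncomputable def distinctSeries : ℤ⟦X⟧ :=
  .mk fun n ↦ ((Nat.Partition.distincts n).card : ℤ)

/-- The power series `∑_{n ≥ 1} (-1)^n X^(n^2)`. -/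
noncomputable def squareSeries : ℤ⟦X⟧ :=
  .mk fun n ↦ if n ≠ 0 ∧ IsSquare n then (-1) ^ n else 0

theorem hasProd_distinctSeries :
    HasProd (fun i ↦ 1 + (X : ℤ⟦X⟧) ^ (i + 1)) distinctSeries := by
  have h := Nat.Partition.hasProd_powerSeriesMk_card_countRestricted ℤ (m := 2) (by norm_num)
  simp only [Finset.sum_range_succ, Finset.sum_range_zero, Nat.Partition.countRestricted_two,
    mul_zero, mul_one, pow_zero, zero_add] at h
  exact h

theorem tendsto_squareSeries :
    Filter.Tendsto (fun n ↦ ∑ s ∈ Finset.range n, (-1) ^ (s + 1) * (X : ℤ⟦X⟧) ^ ((s + 1) ^ 2))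
      Filter.atTop (nhds squareSeries) := by
  rw [PowerSeries.WithPiTopology.tendsto_iff_coeff_tendsto]
  refine fun d ↦ tendsto_atTop_of_eventually_const (i₀ := d) fun n hn ↦ ?_
  have h1 (s : ℕ) : coeff d ((-1) ^ (s + 1) * (X : ℤ⟦X⟧) ^ ((s + 1) ^ 2)) =
      if d = (s + 1) ^ 2 then (-1) ^ d else 0 := by
    have : ((-1) ^ (s + 1) : ℤ⟦X⟧) = C ((-1) ^ (s + 1)) := by simp
    rw [this, coeff_C_mul, coeff_X_pow]
    split_ifs with h
    · subst h
      rw [mul_one, pow_two, pow_mul]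
      rcases Nat.even_or_odd (s + 1) with h | h
      · simp [h.neg_one_pow]
      · simp [h.neg_one_pow]
    · simp
  simp only [map_sum, h1, squareSeries, coeff_mk]
  split_ifs with h
  · obtain ⟨h0, r, rfl⟩ := h
    have hr : r ≠ 0 := by rintro rfl; simp at h0
    obtain ⟨k, rfl⟩ := Nat.exists_eq_succ_of_ne_zero hr
    rw [Finset.sum_eq_single k]
    · simp [pow_two]
    · intro b _ hb
      rw [if_neg]
      intro h
      apply hb
      rw [← pow_two] at h
      have := Nat.pow_left_injective (n := 2) (by norm_num) h
      simp at this
      omega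
    · intro h
      exfalso
      apply h
      simp only [Finset.mem_range]
      nlinarith
  · refine Finset.sum_eq_zero fun s _ ↦ if_neg ?_
    rintro rfl
    exact h ⟨by positivity, s + 1, by ring⟩

theorem distinctSeries_mul_theta :
    distinctSeries * (1 + 2 * squareSeries) = pentagonalSeries ℤ := by
  have hQ := hasProd_distinctSeries.tendsto_prod_nat
  have hP := (PowerSeries.WithPiTopology.hasProd_one_sub_X_pow ℤ).tendsto_prod_nat
  have hL := hQ.mul (tendsto_const_nhds (x := (1 : ℤ⟦X⟧)) |>.add
    ((tendsto_const_nhds (x := (2 : ℤ⟦X⟧))).mul tendsto_squareSeries))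
  refine tendsto_nhds_unique hL ?_
  simp_rw [finite_gauss]
  rw [← add_zero (pentagonalSeries ℤ)]
  refine hP.add ?_
  rw [PowerSeries.WithPiTopology.tendsto_iff_coeff_tendsto]
  refine fun d ↦ tendsto_atTop_of_eventually_const (i₀ := d) fun n hn ↦ ?_
  rw [map_zero]
  have : (X : ℤ⟦X⟧) ^ (n + 1) ∣ 2 *
      ∑ s ∈ Finset.range n, (-1) ^ (s + 1) * X ^ ((s + 1) * (n + 1)) *
          (∏ i ∈ Finset.range s, (1 + X ^ (i + 1))) *
          ∏ i ∈ Finset.Ico (s + 1) n, (1 - X ^ (i + 1)) := by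
    refine Dvd.dvd.mul_left (Finset.dvd_sum fun s _ ↦ ?_) _
    refine Dvd.dvd.mul_right (Dvd.dvd.mul_right (Dvd.dvd.mul_left (pow_dvd_pow _ ?_) _) _) _
    nlinarith
  exact (X_pow_dvd_iff.mp this) d (by omega)

/-- The generating function of the total weight of partitions into distinct parts. -/
noncomputable def weightedSeries (w : ℕ → ℕ) : ℤ⟦X⟧ :=
  .mk fun n ↦ ∑ p ∈ Nat.Partition.distincts n, ((p.parts.map w).sum : ℤ)

theorem continuous_expand {R : Type*} [CommRing R] [TopologicalSpace R] (k : ℕ) (hk : k ≠ 0) :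
    Continuous (PowerSeries.expand k hk : R⟦X⟧ → R⟦X⟧) := by
  rw [continuous_iff_continuousAt]
  intro f
  rw [ContinuousAt, PowerSeries.WithPiTopology.tendsto_iff_coeff_tendsto]
  intro d
  simp only [coeff_expand]
  split_ifs
  · exact (PowerSeries.WithPiTopology.continuous_coeff R _).tendsto f
  · exact tendsto_const_nhds

theorem prod_one_add_mul_eps (w : ℕ → ℕ) (s : Multiset ℕ) :
    (s.map fun i ↦ (1 + (w i : DualNumber ℤ) * DualNumber.eps)).prod =
      1 + ((s.map w).sum : DualNumber ℤ) * DualNumber.eps := by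
  induction s using Multiset.induction_on with
  | empty => simp
  | cons a s ih =>
    simp only [Multiset.map_cons, Multiset.prod_cons, Multiset.sum_cons, ih, Nat.cast_add]
    linear_combination (w a : DualNumber ℤ) * ((s.map w).sum : DualNumber ℤ) *
      DualNumber.eps_mul_eps (R := ℤ)

/-- The generating function of distinct partitions with a part `i` weighted by `1 + w i ε`. -/
noncomputable def dualSeries (w : ℕ → ℕ) : (DualNumber ℤ)⟦X⟧ :=
  map (algebraMap ℤ (DualNumber ℤ)) distinctSeries +
    C DualNumber.eps * map (algebraMap ℤ (DualNumber ℤ)) (weightedSeries w)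

theorem hasProd_dualSeries (w : ℕ → ℕ) :
    HasProd (fun i ↦ 1 + C (1 + (w (i + 1) : DualNumber ℤ) * DualNumber.eps) * X ^ (i + 1))
      (dualSeries w) := by
  convert! Nat.Partition.hasProd_genFun
    (fun i c ↦ if c < 2 then 1 + (w i : DualNumber ℤ) * DualNumber.eps else 0) using 1
  · ext1 i
    rw [tsum_eq_single 0 fun j hj ↦ by simp [hj]]
    simp [smul_eq_C_mul]
  · ext1 n
    rw [Nat.Partition.coeff_genFun, dualSeries, distinctSeries, weightedSeries]
    simp only [map_add, coeff_map, coeff_C_mul, coeff_mk]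
    rw [Finset.card_eq_sum_ones, Nat.cast_sum, map_sum, map_sum, Finset.mul_sum,
      ← Finset.sum_add_distrib, Nat.Partition.distincts, Finset.sum_filter]
    refine Finset.sum_congr rfl fun p _ ↦ ?_
    rw [Finsupp.prod, Multiset.toFinsupp_support]
    split_ifs with h
    · rw [Finset.prod_congr rfl (g := fun i ↦ 1 + (w i : DualNumber ℤ) * DualNumber.eps)]
      · have := prod_one_add_mul_eps w p.parts
        rw [← Multiset.toFinset_eq h]
        change _ = (p.parts.map fun i ↦ (1 + (w i : DualNumber ℤ) * DualNumber.eps)).prod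
        rw [this]
        simp [mul_comm]
      · intro i hi
        refine if_pos ?_
        have := Multiset.nodup_iff_count_le_one.mp h i
        rw [Multiset.toFinsupp_apply]
        omega
    · rw [Multiset.nodup_iff_count_le_one] at h
      push Not at h
      obtain ⟨i, hi⟩ := h
      symm
      refine Finset.prod_eq_zero (i := i) ?_ (if_neg ?_)
      · rw [Multiset.mem_toFinset, ← Multiset.one_le_count_iff_mem]
        omega
      · rw [Multiset.toFinsupp_apply]
        omega

theorem dualSeries_eq_mul_expand (w : ℕ → ℕ) (hw : ∀ k, w (2 * k + 1) = 0) :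
    dualSeries w = (∏' k : ℕ, (1 + X ^ (2 * k + 1))) *
      PowerSeries.expand 2 two_ne_zero (dualSeries fun k ↦ w (2 * k)) := by
  refine (hasProd_dualSeries w).unique (HasProd.even_mul_odd ?_ ?_)
  · simp only [hw, Nat.cast_zero, zero_mul, add_zero, map_one, one_mul]
    refine Multipliable.hasProd ?_
    refine PowerSeries.WithPiTopology.multipliable_one_add_of_tendsto_order_atTop_nhds_top _ ?_
    refine ENat.tendsto_nhds_top_iff_natCast_lt.mpr fun n ↦
      Filter.eventually_atTop.mpr ⟨n, fun m hm ↦ ?_⟩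
    rw [order_X_pow]
    norm_cast
    omega
  · convert! (hasProd_dualSeries fun k ↦ w (2 * k)).map
      (PowerSeries.expand 2 two_ne_zero) (continuous_expand 2 two_ne_zero) using 1
    ext1 k
    simp only [Function.comp_apply, map_add, map_mul, map_one, map_pow, expand_X, expand_C,
      ← pow_mul]
    rfl

/-- Half of an even number, and `0` on odd numbers. -/
def halfEven (i : ℕ) : ℕ := if Even i then i / 2 else 0

theorem weightedSeries_halfEven_mul :
    weightedSeries halfEven * PowerSeries.expand 2 two_ne_zero distinctSeries =
      distinctSeries * PowerSeries.expand 2 two_ne_zero (weightedSeries id) := by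
  have h0 : dualSeries (fun _ ↦ 0) = map (algebraMap ℤ (DualNumber ℤ)) distinctSeries := by
    have : weightedSeries (fun _ ↦ 0) = 0 := by ext n; simp [weightedSeries]
    simp [dualSeries, this]
  have h1 := dualSeries_eq_mul_expand halfEven fun k ↦ by simp [halfEven]
  have h2 := dualSeries_eq_mul_expand (fun _ ↦ 0) fun k ↦ rfl
  have h3 : (fun k ↦ halfEven (2 * k)) = id := by ext k; simp [halfEven]
  rw [h3] at h1
  rw [h0] at h2
  have h4 : dualSeries halfEven * PowerSeries.expand 2 two_ne_zero
      (map (algebraMap ℤ (DualNumber ℤ)) distinctSeries) =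
      map (algebraMap ℤ (DualNumber ℤ)) distinctSeries *
        PowerSeries.expand 2 two_ne_zero (dualSeries id) := by
    rw [h1]
    conv_rhs => rw [h2]
    ring
  rw [dualSeries, dualSeries] at h4
  simp only [map_add, map_mul, expand_C, ← map_expand] at h4
  have h5 : C DualNumber.eps * map (algebraMap ℤ (DualNumber ℤ))
      (weightedSeries halfEven * PowerSeries.expand 2 two_ne_zero distinctSeries) =
      C DualNumber.eps * map (algebraMap ℤ (DualNumber ℤ))
      (distinctSeries * PowerSeries.expand 2 two_ne_zero (weightedSeries id)) := by
    simp only [map_mul]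
    linear_combination h4
  ext n
  have h6 := congrArg (fun f ↦ TrivSqZeroExt.snd (coeff n f)) h5
  rw [coeff_C_mul, coeff_C_mul, coeff_map, coeff_map] at h6
  simpa using h6

theorem coeff_weightedSeries_id (n : ℕ) :
    coeff n (weightedSeries id) = n * coeff n distinctSeries := by
  simp [weightedSeries, distinctSeries, Nat.Partition.parts_sum, mul_comm]

theorem DSOME_eq (n : ℕ) :
    DSOME n = n * coeff n distinctSeries - 4 * coeff n (weightedSeries halfEven) := by
  have key (s : Multiset ℕ) : (((s.filter (fun i ↦ Odd i)).sum : ℤ) -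
      ((s.filter (fun i ↦ Even i)).sum : ℤ)) = s.sum - 4 * (s.map halfEven).sum := by
    induction s using Multiset.induction_on with
    | empty => simp
    | cons a s ih =>
      rcases Nat.even_or_odd a with h | h
      · obtain ⟨k, rfl⟩ := h.two_dvd
        have h' : ¬ Odd (2 * k) := by simp
        simp [Multiset.filter_cons_of_pos _ h,
          Multiset.filter_cons_of_neg (p := fun i ↦ Odd i) s h', halfEven] at ih ⊢
        linarith
      · have h' : ¬ Even a := by simpa using h
        simp [Multiset.filter_cons_of_neg (p := fun i ↦ Even i) s h',
          Multiset.filter_cons_of_pos (p := fun i ↦ Odd i) s h, halfEven, h'] at ih ⊢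
        linarith
  simp only [DSOME, key, Nat.Partition.parts_sum, distinctSeries, weightedSeries, coeff_mk]
  rw [Finset.sum_sub_distrib, Finset.mul_sum]
  simp [mul_comm]

/-- The power series `∑_{n ≥ 1, n even} X^(n^2)`. -/
noncomputable def evenSquareSeries : ℤ⟦X⟧ :=
  .mk fun n ↦ if n ≠ 0 ∧ IsSquare n ∧ Even n then 1 else 0

/-- Reduction modulo two of integral power series. -/
noncomputable def mapTwo : ℤ⟦X⟧ →+* (ZMod 2)⟦X⟧ := map (Int.castRingHom (ZMod 2))

theorem mapTwo_expand (f : ℤ⟦X⟧) :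
    mapTwo (PowerSeries.expand 2 two_ne_zero f) = mapTwo f ^ 2 := by
  have h := MvPowerSeries.map_frobenius_expand (p := 2) two_ne_zero
    (f := (mapTwo f : MvPowerSeries Unit (ZMod 2)))
  have h2 : frobenius (ZMod 2) 2 = RingHom.id _ := ZMod.frobenius_zmod 2
  rw [mapTwo, PowerSeries.map_expand]
  rw [h2, MvPowerSeries.map_id] at h
  exact h

theorem mapTwo_eq_iff {f g : ℤ⟦X⟧} : mapTwo f = mapTwo g ↔ ∀ n, coeff n f ≡ coeff n g [ZMOD 2] := by
  rw [PowerSeries.ext_iff]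
  refine forall_congr' fun n ↦ ?_
  rw [mapTwo, coeff_map, coeff_map]
  exact ZMod.intCast_eq_intCast_iff _ _ 2

theorem coeff_X_mul_derivative (f : ℤ⟦X⟧) (n : ℕ) :
    coeff n (X * d⁄dX ℤ f) = n * coeff n f := by
  cases n with
  | zero => simp
  | succ n => rw [coeff_succ_X_mul, coeff_derivative]; push_cast; ring

theorem X_mul_derivative_expand_two (f : ℤ⟦X⟧) :
    X * d⁄dX ℤ (PowerSeries.expand 2 two_ne_zero f) =
      2 * PowerSeries.expand 2 two_ne_zero (X * d⁄dX ℤ f) := by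
  ext n
  have h2 : (2 : ℤ⟦X⟧) = C 2 := by simp
  rw [coeff_X_mul_derivative, h2, coeff_C_mul, coeff_expand, coeff_expand]
  split_ifs with h
  · obtain ⟨k, rfl⟩ := h
    rw [Nat.mul_div_cancel_left _ two_pos, coeff_X_mul_derivative]
    push_cast
    ring
  · simp

theorem distinctSeries_mul_pentagonalSeries :
    distinctSeries * pentagonalSeries ℤ =
      PowerSeries.expand 2 two_ne_zero (pentagonalSeries ℤ) := by
  have h1 := hasProd_distinctSeries.mul (PowerSeries.WithPiTopology.hasProd_one_sub_X_pow ℤ)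
  have h2 := (PowerSeries.WithPiTopology.hasProd_one_sub_X_pow ℤ).map
    (PowerSeries.expand 2 two_ne_zero) (continuous_expand 2 two_ne_zero)
  refine h1.unique ?_
  convert! h2 using 1
  ext1 i
  simp only [Function.comp_apply, map_sub, map_one, map_pow, expand_X]
  ring

theorem distinctSeries_sq_mul :
    distinctSeries ^ 2 * (1 + 2 * squareSeries) =
      PowerSeries.expand 2 two_ne_zero (pentagonalSeries ℤ) := by
  rw [← distinctSeries_mul_pentagonalSeries, ← distinctSeries_mul_theta]
  ring

theorem weightedSeries_id_eq : weightedSeries id = X * d⁄dX ℤ distinctSeries := by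
  ext n
  rw [coeff_weightedSeries_id, coeff_X_mul_derivative]

theorem derivative_relation :
    distinctSeries * weightedSeries id * (1 + 2 * squareSeries) +
        distinctSeries ^ 2 * (X * d⁄dX ℤ squareSeries) =
      PowerSeries.expand 2 two_ne_zero (weightedSeries id * (1 + 2 * squareSeries) +
        2 * distinctSeries * (X * d⁄dX ℤ squareSeries)) := by
  have h2 : d⁄dX ℤ (2 : ℤ⟦X⟧) = 0 := by
    have : (2 : ℤ⟦X⟧) = C 2 := by simp
    rw [this, derivative_C]
  have h1 := congrArg (fun f ↦ X * d⁄dX ℤ f) distinctSeries_sq_mul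
  simp only [X_mul_derivative_expand_two] at h1
  conv_rhs at h1 => rw [← distinctSeries_mul_theta]
  simp only [Derivation.leibniz, map_add, derivative_one, h2, smul_eq_mul, derivative_pow, mul_zero,
    zero_add, add_zero] at h1
  have h0 : (2 : ℤ⟦X⟧) ≠ 0 := fun h ↦ by
    have := congrArg constantCoeff h
    rw [map_ofNat, map_zero] at this
    omega
  refine mul_left_cancel₀ h0 ?_
  rw [weightedSeries_id_eq]
  have h3 : X * (distinctSeries * (2 * d⁄dX ℤ squareSeries) +
      (1 + 2 * squareSeries) * d⁄dX ℤ distinctSeries) =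
      X * d⁄dX ℤ distinctSeries * (1 + 2 * squareSeries) +
        2 * distinctSeries * (X * d⁄dX ℤ squareSeries) := by ring
  rw [h3] at h1
  rw [← h1]
  push_cast
  ring

theorem isSquare_four_mul {k : ℕ} : IsSquare (4 * k) ↔ IsSquare k := by
  constructor
  · rintro ⟨r, hr⟩
    obtain ⟨t, rfl⟩ : Even r := by
      by_contra h
      rw [Nat.not_even_iff_odd] at h
      have := h.mul h
      rw [← hr] at this
      exact (Nat.not_even_iff_odd.mpr this) ⟨2 * k, by ring⟩
    exact ⟨t, by nlinarith⟩
  · rintro ⟨r, rfl⟩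
    exact ⟨2 * r, by ring⟩

theorem four_dvd_of_isSquare_of_even {n : ℕ} (h : IsSquare n) (h2 : Even n) : 4 ∣ n := by
  obtain ⟨r, rfl⟩ := h
  obtain ⟨t, rfl⟩ : Even r := by simpa [Nat.even_mul] using h2
  exact ⟨t * t, by ring⟩

theorem mapTwo_evenSquareSeries : mapTwo evenSquareSeries = mapTwo squareSeries ^ 4 := by
  have : mapTwo squareSeries ^ 4 = mapTwo (PowerSeries.expand 2 two_ne_zero
      (PowerSeries.expand 2 two_ne_zero squareSeries)) := by
    rw [mapTwo_expand, mapTwo_expand]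
    ring
  rw [this, mapTwo_eq_iff]
  intro n
  rw [← expand_mul, coeff_expand]
  simp only [evenSquareSeries, squareSeries, coeff_mk]
  by_cases h : n ≠ 0 ∧ IsSquare n ∧ Even n
  · obtain ⟨k, rfl⟩ := four_dvd_of_isSquare_of_even h.2.1 h.2.2
    rw [if_pos h, if_pos (by norm_num), if_pos]
    · rcases Nat.even_or_odd (4 * k / (2 * 2)) with h | h <;> simp only [h.neg_one_pow] <;> decide
    · rw [show 4 * k / (2 * 2) = k by omega]
      exact ⟨by omega, isSquare_four_mul.mp h.2.1⟩
  · rw [if_neg h]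
    split_ifs with h1 h2
    · exfalso
      obtain ⟨k, rfl⟩ := h1
      rw [show 2 * 2 * k / (2 * 2) = k by omega] at h2
      exact h ⟨by omega, isSquare_four_mul.mpr h2.2, ⟨2 * k, by ring⟩⟩
    · rfl
    · rfl

theorem mapTwo_derivative_squareSeries :
    mapTwo (X * d⁄dX ℤ squareSeries) = mapTwo squareSeries + mapTwo squareSeries ^ 4 := by
  rw [← mapTwo_evenSquareSeries, ← map_add, mapTwo_eq_iff]
  intro n
  rw [coeff_X_mul_derivative, map_add]
  simp only [evenSquareSeries, squareSeries, coeff_mk]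
  rcases Nat.even_or_odd n with h | h
  · have h2 : (n : ℤ) % 2 = 0 := by obtain ⟨k, rfl⟩ := h; omega
    simp only [h, and_true, h.neg_one_pow]
    split_ifs
    · simp [Int.ModEq]; omega
    · simp
  · have h' : ¬ Even n := by simpa using h
    have h2 : (n : ℤ) % 2 = 1 := by obtain ⟨k, rfl⟩ := h; omega
    simp only [h', and_false, h.neg_one_pow, if_false, add_zero]
    split_ifs
    · simp [Int.ModEq]; omega
    · simp

theorem two_eq_zero_zmodTwo : (2 : (ZMod 2)⟦X⟧) = 0 := by
  have h : (2 : (ZMod 2)⟦X⟧) = C 2 := (map_ofNat C 2).symm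
  rw [h, show (2 : ZMod 2) = 0 by decide, map_zero]

theorem mapTwo_two : mapTwo 2 = 0 := by
  rw [map_ofNat, two_eq_zero_zmodTwo]

theorem mapTwo_weightedSeries_id : mapTwo (weightedSeries id) =
    mapTwo distinctSeries * (mapTwo squareSeries + mapTwo squareSeries ^ 2) := by
  have h := congrArg mapTwo derivative_relation
  have hT := mapTwo_derivative_squareSeries
  generalize X * d⁄dX ℤ squareSeries = T at h hT
  rw [mapTwo_expand] at h
  simp only [map_add, map_mul, map_pow, map_one, hT, mapTwo_two, zero_mul, add_zero, mul_one] at h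
  set F := mapTwo distinctSeries with hF
  set s := mapTwo squareSeries with hs
  set y := mapTwo (weightedSeries id) with hy
  have h2 := two_eq_zero_zmodTwo
  have h3 : (y - F * (s + s ^ 2)) * (F - (y + F * (s + s ^ 2))) = 0 := by
    linear_combination h + F ^ 2 * (s ^ 3 - s) * h2
  rcases mul_eq_zero.mp h3 with h4 | h4
  · exact sub_eq_zero.mp h4
  · exfalso
    have h5 := congrArg constantCoeff h4
    have hs0 : constantCoeff s = 0 := by
      rw [hs, mapTwo, ← coeff_zero_eq_constantCoeff_apply, coeff_map]
      simp [squareSeries]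
    have hy0 : constantCoeff y = 0 := by
      rw [hy, mapTwo, ← coeff_zero_eq_constantCoeff_apply, coeff_map, coeff_weightedSeries_id]
      simp
    have hF0 : constantCoeff F = 1 := by
      have h6 := congrArg constantCoeff (congrArg mapTwo distinctSeries_mul_theta)
      simp only [map_mul, map_add, map_one, map_ofNat, ← hF, ← hs, hs0] at h6
      have h7 : constantCoeff (mapTwo (pentagonalSeries ℤ)) = 1 := by
        rw [mapTwo, ← coeff_zero_eq_constantCoeff_apply, coeff_map]
        have := coeff_pentagonalSeries_pentagonal ℤ 0
        rw [show pentagonal 0 = 0 by simp [pentagonal_def]] at this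
        rw [this]
        simp
      rw [h7] at h6
      simpa using h6
    simp [hs0, hy0, hF0] at h5

theorem mapTwo_weightedSeries_halfEven : mapTwo (weightedSeries halfEven) =
    mapTwo distinctSeries * (mapTwo squareSeries ^ 2 + mapTwo evenSquareSeries) := by
  have h := congrArg mapTwo weightedSeries_halfEven_mul
  rw [map_mul, map_mul, mapTwo_expand, mapTwo_expand, mapTwo_weightedSeries_id] at h
  rw [mapTwo_evenSquareSeries]
  set F := mapTwo distinctSeries with hF
  set s := mapTwo squareSeries with hs
  have hF0 : F ≠ 0 := by
    intro h0
    have h6 := congrArg mapTwo distinctSeries_mul_theta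
    rw [map_mul, ← hF, h0, zero_mul] at h6
    have h7 : coeff 0 (mapTwo (pentagonalSeries ℤ)) = 1 := by
      rw [mapTwo, coeff_map]
      have := coeff_pentagonalSeries_pentagonal ℤ 0
      rw [show pentagonal 0 = 0 by simp [pentagonal_def]] at this
      rw [this]
      simp
    rw [← h6] at h7
    simp at h7
  refine mul_right_cancel₀ (pow_ne_zero 2 hF0) ?_
  rw [h]
  linear_combination F ^ 3 * s ^ 3 * two_eq_zero_zmodTwo

theorem mapTwo_distinctSeries : mapTwo distinctSeries = mapTwo (pentagonalSeries ℤ) := by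
  rw [← distinctSeries_mul_theta]
  simp [mapTwo_two]

/-- The pairs `(j, n)` of integers with `j * (3 * j - 1) / 2 + n ^ 2 = m`. -/
noncomputable def reps (m : ℕ) : Finset (ℤ × ℤ) :=
  (Finset.Icc (-m : ℤ) m ×ˢ Finset.Icc (-m : ℤ) m).filter
    fun z ↦ pentagonal z.1 + z.2.natAbs ^ 2 = m

theorem natAbs_le_pentagonal (j : ℤ) : j.natAbs ≤ pentagonal j := by
  have h := two_mul_natCast_pentagonal j
  rcases le_or_gt j 0 with h1 | h1
  · have : (j.natAbs : ℤ) = -j := by omega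
    zify
    rw [← Int.natCast_natAbs, this]
    nlinarith
  · have : (j.natAbs : ℤ) = j := by omega
    zify
    rw [← Int.natCast_natAbs, this]
    nlinarith

theorem mem_reps {m : ℕ} {z : ℤ × ℤ} :
    z ∈ reps m ↔ (6 * z.1 - 1) ^ 2 + 24 * z.2 ^ 2 = 24 * m + 1 := by
  have h := two_mul_natCast_pentagonal z.1
  have h1 : pentagonal z.1 + z.2.natAbs ^ 2 = m ↔
      (6 * z.1 - 1) ^ 2 + 24 * z.2 ^ 2 = 24 * m + 1 := by
    zify
    rw [sq_abs]
    constructor <;> intro h2 <;> linarith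
  rw [reps, Finset.mem_filter, h1, and_iff_right_iff_imp, ← h1]
  intro h2
  have h3 := natAbs_le_pentagonal z.1
  have h4 : z.2.natAbs ≤ z.2.natAbs ^ 2 := Nat.le_self_pow two_ne_zero _
  simp only [Finset.mem_product, Finset.mem_Icc]
  omega

/-- The signed number of elements `(j, n)` of `reps m`, weighted by `p` for even `n`
and by `q` for odd `n`. -/
noncomputable def repSum (p q : ℤ) (m : ℕ) : ℤ :=
  ∑ z ∈ reps m, (z.1.negOnePow : ℤ) * if Even z.2 then p else q

/-- The power series `∑_{n ∈ ℤ} X^(n^2)`, weighted by `p` for even `n` and by `q` for odd `n`. -/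
noncomputable def thetaSeries (p q : ℤ) : ℤ⟦X⟧ :=
  .mk fun i ↦ (if i = 0 then 1 else if IsSquare i then 2 else 0) * if Even i then p else q

theorem coeff_thetaSeries (p q : ℤ) {m k : ℕ} (hk : k ≤ m) :
    coeff k (thetaSeries p q) = ∑ n ∈ Finset.Icc (-m : ℤ) m,
      if n.natAbs ^ 2 = k then if Even n then p else q else 0 := by
  rw [thetaSeries, coeff_mk]
  rw [← Finset.sum_filter]
  by_cases h : IsSquare k
  · obtain ⟨r, rfl⟩ := h
    have hs : (Finset.Icc (-m : ℤ) m).filter (fun n ↦ n.natAbs ^ 2 = r * r) =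
        {(r : ℤ), -(r : ℤ)} := by
      ext n
      have h4 : r ≤ r * r := Nat.le_mul_self r
      simp only [Finset.mem_filter, Finset.mem_Icc, Finset.mem_insert, Finset.mem_singleton,
        ← pow_two, Nat.pow_left_inj two_ne_zero]
      omega
    rw [hs]
    rcases Nat.eq_zero_or_pos r with rfl | hr
    · simp
    · rw [Finset.sum_pair (by omega), if_neg (by positivity), if_pos ⟨r, rfl⟩]
      simp [Nat.even_mul]
      split_ifs <;> ring
  · have h0 : k ≠ 0 := by rintro rfl; exact h ⟨0, rfl⟩
    rw [if_neg h0, if_neg h, zero_mul, Finset.filter_eq_empty_iff.mpr, Finset.sum_empty]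
    rintro n - rfl
    exact h ⟨n.natAbs, by ring⟩

theorem coeff_pentagonalSeries_eq_sum {m k : ℕ} (hk : k ≤ m) :
    coeff k (pentagonalSeries ℤ) = ∑ j ∈ Finset.Icc (-m : ℤ) m,
      if pentagonal j = k then (j.negOnePow : ℤ) else 0 := by
  by_cases h : k ∈ Set.range pentagonal
  · obtain ⟨j, rfl⟩ := h
    have := natAbs_le_pentagonal j
    rw [coeff_pentagonalSeries_pentagonal, Finset.sum_eq_single j]
    · rw [if_pos rfl]
      rfl
    · intro i _ hi
      rw [if_neg fun h ↦ hi (pentagonal_injective h)]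
    · intro h
      exact absurd (Finset.mem_Icc.mpr (by omega)) h
  · rw [coeff_pentagonalSeries_eq_zero ℤ h]
    exact (Finset.sum_eq_zero fun j _ ↦ if_neg fun h1 ↦ h ⟨j, h1⟩).symm

theorem coeff_pentagonalSeries_mul_thetaSeries (p q : ℤ) (m : ℕ) :
    coeff m (pentagonalSeries ℤ * thetaSeries p q) = repSum p q m := by
  rw [coeff_mul]
  have h1 : ∀ x ∈ Finset.HasAntidiagonal.antidiagonal m,
      coeff x.1 (pentagonalSeries ℤ) * coeff x.2 (thetaSeries p q) =
      ∑ z ∈ Finset.Icc (-m : ℤ) m ×ˢ Finset.Icc (-m : ℤ) m,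
        if (pentagonal z.1, z.2.natAbs ^ 2) = x then
          (z.1.negOnePow : ℤ) * if Even z.2 then p else q else 0 := by
    intro x hx
    rw [Finset.HasAntidiagonal.mem_antidiagonal] at hx
    rw [coeff_pentagonalSeries_eq_sum (show x.1 ≤ m by omega),
      coeff_thetaSeries p q (show x.2 ≤ m by omega), Finset.sum_mul_sum, Finset.sum_product]
    refine Finset.sum_congr rfl fun j _ ↦ Finset.sum_congr rfl fun n _ ↦ ?_
    simp only [Prod.ext_iff]
    by_cases h1 : pentagonal j = x.1 <;> by_cases h2 : n.natAbs ^ 2 = x.2 <;> simp [h1, h2]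
  rw [Finset.sum_congr rfl h1, Finset.sum_comm, repSum, reps, Finset.sum_filter]
  refine Finset.sum_congr rfl fun z _ ↦ ?_
  rw [Finset.sum_ite_eq]
  simp only [Finset.HasAntidiagonal.mem_antidiagonal]

theorem thetaSeries_one_neg_one : thetaSeries 1 (-1) = 1 + 2 * squareSeries := by
  ext n
  rw [map_add, coeff_one, ← map_ofNat C 2, coeff_C_mul, thetaSeries, squareSeries, coeff_mk,
    coeff_mk]
  rcases Nat.eq_zero_or_pos n with rfl | h
  · simp
  · rcases Nat.even_or_odd n with h1 | h1
    · simp [h.ne', h1, h1.neg_one_pow]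
    · simp [h.ne', Nat.not_even_iff_odd.mpr h1, h1.neg_one_pow]
      split_ifs <;> rfl

theorem thetaSeries_one_zero : thetaSeries 1 0 = 1 + 2 * evenSquareSeries := by
  ext n
  rw [map_add, coeff_one, ← map_ofNat C 2, coeff_C_mul, thetaSeries, evenSquareSeries, coeff_mk,
    coeff_mk]
  rcases Nat.eq_zero_or_pos n with rfl | h
  · simp
  · rcases Nat.even_or_odd n with h1 | h1
    · simp [h.ne', h1]
    · simp [h.ne', Nat.not_even_iff_odd.mpr h1]

theorem distinctSeries_eq : distinctSeries =
    3 * (pentagonalSeries ℤ * thetaSeries 1 (-1)) - 2 * pentagonalSeries ℤ +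
      4 * (pentagonalSeries ℤ * squareSeries ^ 2) +
      8 * (pentagonalSeries ℤ * (squareSeries ^ 2 + squareSeries ^ 3) -
        distinctSeries * (squareSeries + squareSeries ^ 2) *
          (1 + 2 * (squareSeries + squareSeries ^ 2))) := by
  rw [thetaSeries_one_neg_one, ← distinctSeries_mul_theta]
  ring

theorem DSOME_modEq_of_forall_ne {m : ℕ}
    (h : ∀ j n : ℤ, (6 * j - 1) ^ 2 + 48 * n ^ 2 ≠ 24 * m + 1) :
    DSOME m ≡ 3 * m * repSum 1 (-1) m + 2 * repSum 1 0 m [ZMOD 8] ∧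
      2 ∣ repSum 1 (-1) m := by
  have hP : coeff m (pentagonalSeries ℤ) = 0 := by
    refine coeff_pentagonalSeries_eq_zero ℤ ?_
    rintro ⟨j, rfl⟩
    refine h j 0 ?_
    linarith [two_mul_natCast_pentagonal j]
  have h2S : coeff m (pentagonalSeries ℤ * PowerSeries.expand 2 two_ne_zero squareSeries) = 0 := by
    rw [coeff_mul]
    refine Finset.sum_eq_zero fun x hx ↦ ?_
    rw [Finset.HasAntidiagonal.mem_antidiagonal] at hx
    by_contra h0
    have h1 := left_ne_zero_of_mul h0
    have h2 := right_ne_zero_of_mul h0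
    have h3 : x.1 ∈ Set.range pentagonal := by
      by_contra h3
      exact h1 (coeff_pentagonalSeries_eq_zero ℤ h3)
    obtain ⟨j, hj⟩ := h3
    rw [coeff_expand] at h2
    split_ifs at h2 with h3
    · obtain ⟨k, hk⟩ := h3
      rw [squareSeries, coeff_mk] at h2
      split_ifs at h2 with h4
      · obtain ⟨-, r, hr⟩ := h4
        refine h j r ?_
        have h5 : (x.2 : ℤ) = 2 * (r * r) := by
          rw [hk, Nat.mul_div_cancel_left _ two_pos] at hr
          rw [hk, hr]
          push_cast
          ring
        have h6 : (x.1 : ℤ) + x.2 = m := by exact_mod_cast hx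
        have := two_mul_natCast_pentagonal j
        rw [hj] at this
        linarith
      · exact h2 rfl
    · exact h2 rfl
  have hS2 : coeff m (pentagonalSeries ℤ * squareSeries ^ 2) ≡ 0 [ZMOD 2] := by
    rw [← h2S]
    refine mapTwo_eq_iff.mp ?_ m
    rw [map_mul, map_mul, mapTwo_expand, map_pow]
  have hV : coeff m (weightedSeries halfEven) ≡
      coeff m (pentagonalSeries ℤ * (squareSeries ^ 2 + evenSquareSeries)) [ZMOD 2] := by
    refine mapTwo_eq_iff.mp ?_ m
    rw [mapTwo_weightedSeries_halfEven, mapTwo_distinctSeries]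
    simp only [map_mul, map_add, map_pow]
  have hQ := congrArg (coeff m) distinctSeries_eq
  rw [← map_ofNat C 2, ← map_ofNat C 3, ← map_ofNat C 4, ← map_ofNat C 8] at hQ
  rw [map_add, map_add, map_sub, coeff_C_mul, coeff_C_mul, coeff_C_mul, coeff_C_mul, hP,
    coeff_pentagonalSeries_mul_thetaSeries] at hQ
  have hb : repSum 1 (-1) m = 2 * coeff m (pentagonalSeries ℤ * squareSeries) := by
    rw [← coeff_pentagonalSeries_mul_thetaSeries, thetaSeries_one_neg_one, mul_add, mul_one,
      map_add, hP, ← map_ofNat C 2, mul_left_comm, coeff_C_mul, zero_add]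
  have ha : repSum 1 0 m = 2 * coeff m (pentagonalSeries ℤ * evenSquareSeries) := by
    rw [← coeff_pentagonalSeries_mul_thetaSeries, thetaSeries_one_zero, mul_add, mul_one,
      map_add, hP, ← map_ofNat C 2, mul_left_comm, coeff_C_mul, zero_add]
  refine ⟨?_, hb ▸ dvd_mul_right _ _⟩
  rw [mul_add, map_add] at hV
  rw [DSOME_eq, ha]
  obtain ⟨e, he⟩ : ∃ e, coeff m distinctSeries = 3 * repSum 1 (-1) m - 2 * 0 +
      4 * coeff m (pentagonalSeries ℤ * squareSeries ^ 2) + 8 * e := ⟨_, hQ⟩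
  clear hQ
  obtain ⟨u, hu⟩ := hS2.dvd
  obtain ⟨v, hv⟩ := hV.dvd
  generalize repSum 1 (-1) m = b at *
  generalize coeff m (weightedSeries halfEven) = V at *
  generalize coeff m distinctSeries = Q at *
  generalize coeff m (pentagonalSeries ℤ * squareSeries ^ 2) = c at *
  generalize coeff m (pentagonalSeries ℤ * evenSquareSeries) = a at *
  refine Int.modEq_iff_dvd.mpr ⟨m * u - m * e + V + v + u, ?_⟩
  rw [he]
  linear_combination (4 * m + 4) * hu + 4 * hv

theorem summand_shift (p q : ℤ) {j n a b : ℤ} (ha : Even a) (hb : Odd b) :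
    ((j + a).negOnePow : ℤ) * (if Even (n + b) then p else q) =
      (j.negOnePow : ℤ) * if Even n then q else p := by
  rw [Int.negOnePow_add, Int.negOnePow_even a ha, mul_one]
  by_cases h : Even n <;> simp [Int.even_add, h, Int.not_even_iff_odd.mpr hb]

theorem sum_reps_filter_sub (p q : ℤ) (m : ℕ) :
    ∑ z ∈ (reps (25 * m + 1)).filter (fun z ↦ 25 ∣ z.2 - (6 * z.1 - 1)),
      ((z.1.negOnePow : ℤ) * if Even z.2 then p else q) = repSum q p m := by
  symm
  refine Finset.sum_bij' (fun z _ ↦ (z.1 + -4 * z.2, z.2 + (6 * z.1 - 1)))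
    (fun z _ ↦ (z.1 + 4 * ((z.2 - (6 * z.1 - 1)) / 25), (z.2 - (6 * z.1 - 1)) / 25)) ?_ ?_ ?_ ?_ ?_
  · intro z hz
    rw [mem_reps] at hz
    rw [Finset.mem_filter, mem_reps]
    push_cast
    exact ⟨by linear_combination 25 * hz, z.2, by ring⟩
  · intro z hz
    rw [Finset.mem_filter, mem_reps] at hz
    obtain ⟨hz, k, hk⟩ := hz
    rw [hk, Int.mul_ediv_cancel_left _ (by norm_num), mem_reps]
    have h2 : z.2 = 25 * k + (6 * z.1 - 1) := by linarith
    rw [h2] at hz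
    push_cast at hz
    linarith
  · intro z _
    rw [show z.2 + (6 * z.1 - 1) - (6 * (z.1 + -4 * z.2) - 1) = 25 * z.2 by ring,
      Int.mul_ediv_cancel_left _ (by norm_num)]
    ext <;> simp
  · intro z hz
    rw [Finset.mem_filter, mem_reps] at hz
    obtain ⟨hz, k, hk⟩ := hz
    rw [hk, Int.mul_ediv_cancel_left _ (by norm_num)]
    ext
    · simp
    · simp only; linarith
  · intro z _
    exact (summand_shift p q ⟨-2 * z.2, by ring⟩ ⟨3 * z.1 - 1, by ring⟩).symm

theorem sum_reps_filter_add (p q : ℤ) (m : ℕ) :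
    ∑ z ∈ (reps (25 * m + 1)).filter (fun z ↦ 25 ∣ z.2 + (6 * z.1 - 1)),
      ((z.1.negOnePow : ℤ) * if Even z.2 then p else q) = repSum q p m := by
  symm
  refine Finset.sum_bij' (fun z _ ↦ (z.1 + 4 * z.2, z.2 + -(6 * z.1 - 1)))
    (fun z _ ↦ (z.1 - 4 * ((z.2 + (6 * z.1 - 1)) / 25), (z.2 + (6 * z.1 - 1)) / 25)) ?_ ?_ ?_ ?_ ?_
  · intro z hz
    rw [mem_reps] at hz
    rw [Finset.mem_filter, mem_reps]
    push_cast
    exact ⟨by linear_combination 25 * hz, z.2, by ring⟩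
  · intro z hz
    rw [Finset.mem_filter, mem_reps] at hz
    obtain ⟨hz, k, hk⟩ := hz
    rw [hk, Int.mul_ediv_cancel_left _ (by norm_num), mem_reps]
    have h2 : z.2 = 25 * k - (6 * z.1 - 1) := by linarith
    rw [h2] at hz
    push_cast at hz
    linarith
  · intro z _
    rw [show z.2 + -(6 * z.1 - 1) + (6 * (z.1 + 4 * z.2) - 1) = 25 * z.2 by ring,
      Int.mul_ediv_cancel_left _ (by norm_num)]
    ext <;> simp
  · intro z hz
    rw [Finset.mem_filter, mem_reps] at hz
    obtain ⟨hz, k, hk⟩ := hz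
    rw [hk, Int.mul_ediv_cancel_left _ (by norm_num)]
    ext
    · simp
    · simp only; linarith
  · intro z _
    exact (summand_shift p q ⟨2 * z.2, by ring⟩ ⟨-3 * z.1, by ring⟩).symm

theorem sum_reps_filter_and (p q : ℤ) (m : ℕ) :
    ∑ z ∈ (reps (25 * (25 * m + 1) + 1)).filter
        (fun z ↦ 25 ∣ z.2 - (6 * z.1 - 1) ∧ 25 ∣ z.2 + (6 * z.1 - 1)),
      ((z.1.negOnePow : ℤ) * if Even z.2 then p else q) = repSum p q m := by
  symm
  refine Finset.sum_bij' (fun z _ ↦ (z.1 + (24 * z.1 - 4), 25 * z.2))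
    (fun z _ ↦ ((z.1 + 4) / 25, z.2 / 25)) ?_ ?_ ?_ ?_ ?_
  · intro z hz
    rw [mem_reps] at hz
    rw [Finset.mem_filter, mem_reps]
    push_cast
    exact ⟨by linear_combination 625 * hz, by omega, by omega⟩
  · intro z hz
    rw [Finset.mem_filter, mem_reps] at hz
    obtain ⟨hz, h1, h2⟩ := hz
    obtain ⟨k, hk⟩ : 25 ∣ z.1 + 4 := by omega
    obtain ⟨l, hl⟩ : 25 ∣ z.2 := by omega
    rw [hk, hl, Int.mul_ediv_cancel_left _ (by norm_num), Int.mul_ediv_cancel_left _ (by norm_num),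
      mem_reps]
    rw [hl, show z.1 = 25 * k - 4 by linarith] at hz
    push_cast at hz
    linarith
  · intro z _
    ext <;> simp only <;> omega
  · intro z hz
    rw [Finset.mem_filter, mem_reps] at hz
    obtain ⟨hz, h1, h2⟩ := hz
    ext <;> simp only <;> omega
  · intro z _
    have h24 : Even (24 * z.1 - 4) := ⟨12 * z.1 - 2, by ring⟩
    rw [Int.negOnePow_add, Int.negOnePow_even _ h24, mul_one]
    have : Even (25 * z.2) ↔ Even z.2 := by
      rw [Int.even_mul, or_iff_right (by decide)]
    simp only [this]

theorem dvd_sub_or_dvd_add {x n k : ℤ} (h : x ^ 2 + 24 * n ^ 2 = 125 * k) :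
    25 ∣ n - x ∨ 25 ∣ n + x := by
  have h5 : Prime (5 : ℤ) := by norm_num
  by_cases h1 : 5 ∣ n - x
  · by_cases h2 : 5 ∣ n + x
    · obtain ⟨a, rfl⟩ : 5 ∣ x := by omega
      obtain ⟨b, rfl⟩ : 5 ∣ n := by omega
      have h3 : (5 : ℤ) ∣ (b - a) * (b + a) := ⟨5 * b ^ 2 - k, by linarith⟩
      rcases h5.dvd_or_dvd h3 with h4 | h4 <;> omega
    · left
      have h3 : (5 : ℤ) ^ 2 ∣ (n - x) * (n + x) := ⟨n ^ 2 - 5 * k, by linarith⟩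
      exact ((h5.coprime_iff_not_dvd.mpr h2).pow_left).dvd_of_dvd_mul_right h3
  · right
    have h3 : (5 : ℤ) ^ 2 ∣ (n - x) * (n + x) := ⟨n ^ 2 - 5 * k, by linarith⟩
    exact ((h5.coprime_iff_not_dvd.mpr h1).pow_left).dvd_of_dvd_mul_left h3

theorem repSum_add_sum_filter (p q : ℤ) {m : ℕ} (hm : 5 ∣ 24 * m + 1) :
    repSum p q (25 * m + 1) + ∑ z ∈ (reps (25 * m + 1)).filter
        (fun z ↦ 25 ∣ z.2 - (6 * z.1 - 1) ∧ 25 ∣ z.2 + (6 * z.1 - 1)),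
      ((z.1.negOnePow : ℤ) * if Even z.2 then p else q) = 2 * repSum q p m := by
  have h : (reps (25 * m + 1)).filter
      (fun z ↦ 25 ∣ z.2 - (6 * z.1 - 1) ∨ 25 ∣ z.2 + (6 * z.1 - 1)) = reps (25 * m + 1) := by
    refine Finset.filter_true_of_mem fun z hz ↦ ?_
    rw [mem_reps] at hz
    obtain ⟨k, hk⟩ := hm
    have : (24 * m + 1 : ℤ) = 5 * k := by exact_mod_cast hk
    refine dvd_sub_or_dvd_add (k := k) ?_
    push_cast at hz
    linarith
  rw [Finset.filter_and, two_mul]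
  nth_rewrite 1 [← sum_reps_filter_sub p q m]
  rw [← sum_reps_filter_add p q m, ← Finset.sum_union_inter, ← Finset.filter_or, h, repSum]

theorem repSum_of_not_dvd (p q : ℤ) {m : ℕ} (hm : 5 ∣ 24 * m + 1) (hm2 : ¬ 25 ∣ 24 * m + 1) :
    repSum p q (25 * m + 1) = 2 * repSum q p m := by
  rw [← repSum_add_sum_filter p q hm, left_eq_add, Finset.filter_eq_empty_iff.mpr, Finset.sum_empty]
  rintro z hz ⟨h1, h2⟩
  rw [mem_reps] at hz
  obtain ⟨a, ha⟩ : 25 ∣ 6 * z.1 - 1 := by omega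
  obtain ⟨b, hb⟩ : 25 ∣ z.2 := by omega
  rw [ha, hb] at hz
  push_cast at hz
  refine hm2 ?_
  zify
  exact ⟨a ^ 2 + 24 * b ^ 2, by linarith⟩

theorem repSum_add_repSum (p q : ℤ) (m : ℕ) :
    repSum p q (25 * (25 * m + 1) + 1) + repSum p q m = 2 * repSum q p (25 * m + 1) := by
  rw [← repSum_add_sum_filter p q (by omega), sum_reps_filter_and]

theorem five_dvd_of_five_dvd {x n : ℤ} (h : 5 ∣ x ^ 2 + 48 * n ^ 2) : 5 ∣ x ∧ 5 ∣ n := by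
  have h5 : (5 : ℤ) ∣ x ^ 2 + 48 * n ^ 2 → (x : ZMod 5) = 0 ∧ (n : ZMod 5) = 0 := by
    intro h
    have h1 := (ZMod.intCast_zmod_eq_zero_iff_dvd (x ^ 2 + 48 * n ^ 2) 5).mpr (by exact_mod_cast h)
    push_cast at h1
    generalize (x : ZMod 5) = a at *
    generalize (n : ZMod 5) = b at *
    revert a b
    decide
  obtain ⟨h1, h2⟩ := h5 h
  exact ⟨by exact_mod_cast (ZMod.intCast_zmod_eq_zero_iff_dvd x 5).mp h1,
    by exact_mod_cast (ZMod.intCast_zmod_eq_zero_iff_dvd n 5).mp h2⟩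

theorem sq_add_ne {k : ℤ} (h5 : 5 ∣ k) (h25 : ¬ 25 ∣ k) (x n : ℤ) : x ^ 2 + 48 * n ^ 2 ≠ k := by
  rintro rfl
  obtain ⟨⟨a, rfl⟩, ⟨b, rfl⟩⟩ := five_dvd_of_five_dvd h5
  exact h25 ⟨a ^ 2 + 48 * b ^ 2, by ring⟩

theorem sq_add_ne_mul {k : ℤ} (h : ∀ x n : ℤ, x ^ 2 + 48 * n ^ 2 ≠ k) (x n : ℤ) :
    x ^ 2 + 48 * n ^ 2 ≠ 25 * k := by
  intro h1
  obtain ⟨⟨a, rfl⟩, ⟨b, rfl⟩⟩ := five_dvd_of_five_dvd (x := x) (n := n) ⟨5 * k, by linarith⟩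
  exact h a b (by linarith)

theorem DSOME_internal_congruence' (n r : ℕ) (hr1 : 1 ≤ r) (hr4 : r ≤ 4) :
    DSOME (15625 * n + 3125 * r + 651) ≡
      5 * DSOME (25 * n + 5 * r + 1) + DSOME (625 * n + 125 * r + 26) [ZMOD 8] := by
  obtain ⟨m, hm⟩ : ∃ m, m = 25 * n + 5 * r + 1 := ⟨_, rfl⟩
  rw [show 15625 * n + 3125 * r + 651 = 25 * (25 * m + 1) + 1 by omega,
    show 625 * n + 125 * r + 26 = 25 * m + 1 by omega, ← hm]
  have h5 : 5 ∣ 24 * m + 1 := by omega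
  have h25 : ¬ 25 ∣ 24 * m + 1 := by omega
  have n1 := sq_add_ne (k := 24 * m + 1) (by omega) (by omega)
  have n3 := sq_add_ne_mul n1
  have n5 := sq_add_ne_mul n3
  obtain ⟨d1, b, hb⟩ := DSOME_modEq_of_forall_ne (m := m) fun j n ↦ n1 _ _
  obtain ⟨d3, -⟩ := DSOME_modEq_of_forall_ne (m := 25 * m + 1) fun j n ↦ by
    convert n3 (6 * j - 1) n using 1
    push_cast
    ring
  obtain ⟨d5, -⟩ := DSOME_modEq_of_forall_ne (m := 25 * (25 * m + 1) + 1) fun j n ↦ by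
    convert n5 (6 * j - 1) n using 1
    push_cast
    ring
  have e1 := repSum_of_not_dvd 1 (-1) h5 h25
  have e2 := repSum_of_not_dvd 1 0 h5 h25
  have e3 := repSum_of_not_dvd (-1) 1 h5 h25
  have e4 := repSum_of_not_dvd 0 1 h5 h25
  have e5 := repSum_add_repSum 1 (-1) m
  have e6 := repSum_add_repSum 1 0 m
  have e7 : repSum (-1) 1 m = -repSum 1 (-1) m := by
    simp [repSum, ← Finset.sum_neg_distrib, neg_ite]
  have e8 : repSum 0 1 m = repSum 1 0 m - repSum 1 (-1) m := by
    rw [repSum, repSum, repSum, ← Finset.sum_sub_distrib]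
    refine Finset.sum_congr rfl fun z _ ↦ ?_
    split_ifs <;> ring
  obtain ⟨u, hu⟩ := d1.dvd
  obtain ⟨v, hv⟩ := d3.dvd
  obtain ⟨w, hw⟩ := d5.dvd
  have r3b : repSum 1 (-1) (25 * m + 1) = -4 * b := by linarith
  have r3a : repSum 1 0 (25 * m + 1) = 2 * (repSum 1 0 m - 2 * b) := by linarith
  have r5b : repSum 1 (-1) (25 * (25 * m + 1) + 1) = 6 * b := by linarith
  have r5a : repSum 1 0 (25 * (25 * m + 1) + 1) = 3 * repSum 1 0 m := by linarith
  rw [hb] at hu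
  rw [r3b, r3a] at hv
  rw [r5b, r5a] at hw
  push_cast at hv hw
  rw [Int.modEq_iff_dvd]
  refine ⟨repSum 1 0 m - b * (1440 * m + 61) - 5 * u - v + w, ?_⟩
  linear_combination hw - hv - 5 * hu
end
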